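/- Let C be a small ℂ-linear category and let ψ ∈ CN^n(C) be such that bψ ∈ C^{n+1}_λ(C) = Ker(1−λ). Then: (1) Bψ is a cyclic cocycle, i.e. b(Bψ) = 0 and (1−λ)(Bψ) = 0; (2) S(Bψ) = n(n+1)·bψ in H^{n+1}_λ(C), i.e. S(Bψ) − n(n+1)bψ is a coboundary of the cyclic complex. -/

import Mathlib

open scoped BigOperators TensorProduct

/-! ### Small `k`-linear (semi)categories -/

/-- A small `k`-linear semicategory: a "category possibly without identities"
whose Hom-sets are `k`-modules and whose composition is `k`-bilinear. -/
structure SemiCat (k : Type) [CommRing k] where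
  Obj : Type
  Hom : Obj → Obj → Type
  acg : ∀ X Y, AddCommGroup (Hom X Y)
  mod : ∀ X Y, Module k (Hom X Y)
  comp : ∀ {X Y Z}, Hom Y Z → Hom X Y → Hom X Z
  comp_add_left : ∀ {X Y Z} (g g' : Hom Y Z) (f : Hom X Y),
    comp (g + g') f = comp g f + comp g' f
  comp_add_right : ∀ {X Y Z} (g : Hom Y Z) (f f' : Hom X Y),
    comp g (f + f') = comp g f + comp g f'
  comp_smul_left : ∀ {X Y Z} (c : k) (g : Hom Y Z) (f : Hom X Y),
    comp (c • g) f = c • comp g f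
  comp_smul_right : ∀ {X Y Z} (c : k) (g : Hom Y Z) (f : Hom X Y),
    comp g (c • f) = c • comp g f
  comp_assoc : ∀ {W X Y Z} (h : Hom Y Z) (g : Hom X Y) (f : Hom W X),
    comp (comp h g) f = comp h (comp g f)

attribute [instance] SemiCat.acg SemiCat.mod

/-- A small `k`-linear category (a `k`-linear semicategory with identities). -/
structure LinCat (k : Type) [CommRing k] extends SemiCat k where
  id : ∀ X, Hom X X
  id_comp : ∀ {X Y} (f : Hom X Y), comp (id Y) f = f
  comp_id : ∀ {X Y} (f : Hom X Y), comp f (id X) = f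

namespace SemiCat

variable {k : Type} [CommRing k] (D : SemiCat k)

/-- The type of morphisms of `D`, bundled with their domain and codomain. -/
def M : Type := Σ (A B : D.Obj), D.Hom A B

/-- Domain of a bundled morphism. -/
def dom (x : D.M) : D.Obj := x.1

/-- Codomain of a bundled morphism. -/
def cod (x : D.M) : D.Obj := x.2.1

open Classical in
/-- Composition of bundled morphisms `x ∘ y` (first `y`, then `x`); if the
endpoints do not match, the zero morphism is returned. -/
noncomputable def sc (x y : D.M) : D.M :=
  if h : y.2.1 = x.1 then ⟨y.1, x.2.1, D.comp x.2.2 (cast (by rw [h]) y.2.2)⟩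
  else ⟨y.1, x.2.1, 0⟩

/-- Replace the underlying morphism of a bundled morphism (same endpoints). -/
def setM (x : D.M) (f : D.Hom x.1 x.2.1) : D.M := ⟨x.1, x.2.1, f⟩

end SemiCat

namespace LinCat

variable {k : Type} [CommRing k] (D : LinCat k)

/-- The identity on `X` as a bundled morphism. -/
def idM (X : D.Obj) : D.toSemiCat.M := ⟨X, X, D.id X⟩

/-! ### The cyclic nerve and cochains.

A degree `n` "cyclic tuple" on `D` is a tuple `(f⁰, f¹, …, fⁿ)` of bundled
morphisms; it is *cyclically composable* when `f i : X_{i+1} → X_i` with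
indices mod `n+1`.  An `n`-cochain, i.e. an element of
`CN^n(D) = Hom_k(CN_n(D), k)`, is modelled as a function on all degree `n`
tuples which is `k`-multilinear in each slot and vanishes on tuples that are
not cyclically composable; such functions correspond exactly to linear
functionals on `CN_n(D) = ⊕ Hom(X₁,X₀) ⊗ ⋯ ⊗ Hom(X₀,Xₙ)`. -/

/-- Degree `n` tuples of bundled morphisms. -/
def Tup (n : ℕ) : Type := Fin (n + 1) → D.toSemiCat.M

/-- Cyclic composability of a tuple: the domain of `f i` is the codomain of
`f (i+1)` (cyclically). -/
def IsCyc {n : ℕ} (F : D.Tup n) : Prop :=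
  ∀ i : Fin (n + 1), (F i).2.1 = (F (i - 1)).1

/-- Update slot `i` of a tuple, keeping its endpoints. -/
def upd {n : ℕ} (F : D.Tup n) (i : Fin (n + 1)) (f : D.Hom (F i).1 (F i).2.1) :
    D.Tup n :=
  Function.update F i ⟨(F i).1, (F i).2.1, f⟩

/-- The predicate expressing that a function on degree `n` tuples is an
`n`-cochain on the cyclic nerve of `D`, i.e. a linear functional on
`CN_n(D)`. -/
structure IsCochain {n : ℕ} (φ : D.Tup n → k) : Prop where
  map_add : ∀ (F : D.Tup n) (i : Fin (n + 1)) (f g : D.Hom (F i).1 (F i).2.1),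
    φ (D.upd F i (f + g)) = φ (D.upd F i f) + φ (D.upd F i g)
  map_smul : ∀ (F : D.Tup n) (i : Fin (n + 1)) (c : k) (f : D.Hom (F i).1 (F i).2.1),
    φ (D.upd F i (c • f)) = c * φ (D.upd F i f)
  supported : ∀ F : D.Tup n, ¬ D.IsCyc F → φ F = 0

/-! ### The cocyclic structure on `CN^•(D)` (trivial Hopf algebra case) -/

variable {n : ℕ}

/-- The cyclic rotation on tuples: `(f⁰,…,fⁿ) ↦ (fⁿ, f⁰, …, f^{n-1})`. -/
def rotT (F : D.Tup n) : D.Tup n :=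
  fun j => if j = 0 then F (Fin.last n) else F (j - 1)

/-- The (unsigned) cyclic operator `τ_n` on cochains. -/
def tauOp (φ : D.Tup n → k) : D.Tup n → k := fun F => φ (D.rotT F)

/-- The signed cyclic operator `λ = (-1)ⁿ τ_n`. -/
def lamOp (φ : D.Tup n → k) : D.Tup n → k := fun F => (-1 : k) ^ n * D.tauOp φ F

/-- The tuple obtained by composing the entries at slots `i` and `i+1`
(`0 ≤ i ≤ n`); used for the face maps `δ_0, …, δ_n`. -/
noncomputable def faceT (i : ℕ) (F : D.Tup (n + 1)) : D.Tup n := fun j =>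
  if j.val < i then F ⟨j.val, by omega⟩
  else if j.val = i then
    D.toSemiCat.sc (F ⟨min i (n + 1), by omega⟩) (F ⟨min (i + 1) (n + 1), by omega⟩)
  else F ⟨j.val + 1, by omega⟩

/-- The tuple implementing the last face map
`(f⁰,…,f^{n+1}) ↦ ((f^{n+1} ∘ f⁰), f¹, …, fⁿ)`. -/
noncomputable def lastFaceT (F : D.Tup (n + 1)) : D.Tup n := fun j =>
  if j = 0 then D.toSemiCat.sc (F (Fin.last (n + 1))) (F 0)
  else F ⟨j.val, by omega⟩

/-- The coface operators `δ_i : CN^n(D) → CN^{n+1}(D)`, `0 ≤ i ≤ n+1`. -/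
noncomputable def deltaOp (i : Fin (n + 2)) (φ : D.Tup n → k) : D.Tup (n + 1) → k :=
  fun F => if i.val ≤ n then φ (D.faceT i.val F) else φ (D.lastFaceT F)

/-- The Hochschild coboundary `b = ∑ (-1)^i δ_i : CN^n(D) → CN^{n+1}(D)`. -/
noncomputable def bOp (φ : D.Tup n → k) : D.Tup (n + 1) → k :=
  fun F => ∑ i : Fin (n + 2), (-1 : k) ^ (i : ℕ) * D.deltaOp i φ F

/-- The truncated coboundary `b' = ∑_{i=0}^{n} (-1)^i δ_i` (last face omitted). -/
noncomputable def bPrimeOp (φ : D.Tup n → k) : D.Tup (n + 1) → k :=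
  fun F => ∑ i : Fin (n + 1), (-1 : k) ^ (i : ℕ) * D.deltaOp i.castSucc φ F

/-- The tuple inserting an identity after slot `i` (`0 ≤ i ≤ n`); for `i = n`
this inserts `id_{X₀}` at the end. -/
noncomputable def degT (i : ℕ) (F : D.Tup n) : D.Tup (n + 1) := fun j =>
  if hj : j.val ≤ i ∧ j.val ≤ n then F ⟨j.val, by omega⟩
  else if j.val = i + 1 then D.idM ((F ⟨min i n, by omega⟩).1)
  else F ⟨j.val - 1, by omega⟩

/-- The codegeneracy operators `σ_i : CN^{n+1}(D) → CN^n(D)`, `0 ≤ i ≤ n`. -/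
noncomputable def sigmaOp (i : Fin (n + 1)) (ψ : D.Tup (n + 1) → k) : D.Tup n → k :=
  fun F => ψ (D.degT i.val F)

/-- The norm operator `A = 1 + λ + λ² + ⋯ + λⁿ` on `CN^n(D)`. -/
def AOp (φ : D.Tup n → k) : D.Tup n → k :=
  fun F => ∑ i ∈ Finset.range (n + 1), (D.lamOp)^[i] φ F

/-- The tuple `(id_{X₀}, f⁰, …, fⁿ)`. -/
def consIdT (F : D.Tup n) : D.Tup (n + 1) := fun j =>
  if j = 0 then D.idM ((F 0).2.1) else F ⟨j.val - 1, by omega⟩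

/-- The tuple `(f⁰, …, fⁿ, id_{X₀})`. -/
def snocIdT (F : D.Tup n) : D.Tup (n + 1) := fun j =>
  if hj : j.val ≤ n then F ⟨j.val, by omega⟩ else D.idM ((F 0).2.1)

/-- The operator `B₀ : CN^{n+1}(D) → CN^n(D)`. -/
def B0Op (ψ : D.Tup (n + 1) → k) : D.Tup n → k :=
  fun F => ψ (D.consIdT F) - (-1 : k) ^ (n + 1) * ψ (D.snocIdT F)

/-- Connes' operator `B = A ∘ B₀ : CN^{n+1}(D) → CN^n(D)`. -/
def BOp (ψ : D.Tup (n + 1) → k) : D.Tup n → k := D.AOp (D.B0Op ψ)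

/-- Cyclic cochains: `C^n_λ(D) = Ker(1-λ)`. -/
def IsCyclicCochain (φ : D.Tup n → k) : Prop := D.IsCochain φ ∧ D.lamOp φ = φ

/-- Cyclic cocycles `Z^n_λ(D)`. -/
noncomputable def IsCocycle (φ : D.Tup n → k) : Prop :=
  D.IsCochain φ ∧ D.lamOp φ = φ ∧ D.bOp φ = 0

/-- Cyclic coboundaries `B^{n+1}_λ(D)`: elements `b ψ` for a cyclic `n`-cochain `ψ`. -/
noncomputable def IsCoboundary (φ : D.Tup (n + 1) → k) : Prop :=
  ∃ ψ : D.Tup n → k, D.IsCochain ψ ∧ D.lamOp ψ = ψ ∧ D.bOp ψ = φ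

end LinCat

/-! ### Differential graded semicategories, closed graded traces and cycles -/

/-- A (small) differential graded semicategory with object type `Obj`:
the Hom's are nonnegatively graded `k`-modules, composition is bilinear,
associative and additive in the degrees, and the differential `d` has degree
`+1`, squares to zero and satisfies the graded Leibniz rule. -/
structure DGStr (k : Type) [CommRing k] (Obj : Type) where
  Hom : Obj → Obj → ℕ → Type
  acg : ∀ X Y n, AddCommGroup (Hom X Y n)
  mod : ∀ X Y n, Module k (Hom X Y n)
  /-- transport along an equality of degrees -/
  cst : ∀ {X Y : Obj} {m n : ℕ}, m = n → Hom X Y m → Hom X Y n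
  cst_rfl : ∀ {X Y : Obj} {n : ℕ} (f : Hom X Y n), cst rfl f = f
  comp : ∀ {X Y Z : Obj} {i j : ℕ}, Hom Y Z i → Hom X Y j → Hom X Z (i + j)
  comp_add_left : ∀ {X Y Z i j} (g g' : Hom Y Z i) (f : Hom X Y j),
    comp (g + g') f = comp g f + comp g' f
  comp_add_right : ∀ {X Y Z i j} (g : Hom Y Z i) (f f' : Hom X Y j),
    comp g (f + f') = comp g f + comp g f'
  comp_smul_left : ∀ {X Y Z i j} (c : k) (g : Hom Y Z i) (f : Hom X Y j),
    comp (c • g) f = c • comp g f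
  comp_smul_right : ∀ {X Y Z i j} (c : k) (g : Hom Y Z i) (f : Hom X Y j),
    comp g (c • f) = c • comp g f
  comp_assoc : ∀ {W X Y Z} {i j l} (h : Hom Y Z i) (g : Hom X Y j) (f : Hom W X l),
    comp h (comp g f) = cst (by omega) (comp (comp h g) f)
  d : ∀ {X Y : Obj} {n : ℕ}, Hom X Y n → Hom X Y (n + 1)
  d_add : ∀ {X Y n} (f g : Hom X Y n), d (f + g) = d f + d g
  d_smul : ∀ {X Y n} (c : k) (f : Hom X Y n), d (c • f) = c • d f
  d_sq : ∀ {X Y n} (f : Hom X Y n), d (d f) = 0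
  leibniz : ∀ {X Y Z i j} (g : Hom Y Z i) (f : Hom X Y j),
    d (comp g f) = cst (by omega) (comp (d g) f) + (-1 : k) ^ i • comp g (d f)

attribute [instance] DGStr.acg DGStr.mod

namespace DGStr

variable {k : Type} [CommRing k] {Obj : Type} (S : DGStr k Obj)

/-- Bundled (homogeneous) morphisms of a DG semicategory. -/
def M : Type := Σ (A B : Obj) (n : ℕ), S.Hom A B n

open Classical in
/-- Composition of bundled morphisms (zero morphism if endpoints mismatch). -/
noncomputable def sc (x y : S.M) : S.M :=
  if h : y.2.1 = x.1 then
    ⟨y.1, x.2.1, x.2.2.1 + y.2.2.1,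
      S.comp x.2.2.2 (cast (congrArg (fun A => S.Hom y.1 A y.2.2.1) h) y.2.2.2)⟩
  else ⟨y.1, x.2.1, x.2.2.1 + y.2.2.1, 0⟩

/-- The differential on bundled morphisms. -/
def dM (x : S.M) : S.M := ⟨x.1, x.2.1, x.2.2.1 + 1, S.d x.2.2.2⟩

/-- Left-to-right composition of a nonempty list of bundled morphisms. -/
noncomputable def prodM (x : S.M) (l : List S.M) : S.M := l.foldl S.sc x

end DGStr

/-- A closed graded trace of dimension `n` on a DG semicategory `S`
(trivial Hopf algebra, trivial coefficients). -/
structure GrTrace {k : Type} [CommRing k] {Obj : Type} (S : DGStr k Obj) (n : ℕ) where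
  T : ∀ X : Obj, S.Hom X X n → k
  T_add : ∀ X (f g : S.Hom X X n), T X (f + g) = T X f + T X g
  T_smul : ∀ X (c : k) (f : S.Hom X X n), T X (c • f) = c * T X f
  /-- `T(∂ f') = 0` for `f'` of degree `n - 1`. -/
  T_closed : ∀ (X : Obj) (m : ℕ) (hm : m + 1 = n) (f : S.Hom X X m),
    T X (S.cst hm (S.d f)) = 0
  /-- the graded trace property `T(g' g) = (-1)^{ij} T(g g')`. -/
  T_graded : ∀ (X Y : Obj) (i j : ℕ) (hij : i + j = n)
    (g : S.Hom X Y i) (g' : S.Hom Y X j),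
    T X (S.cst (by omega) (S.comp g' g)) = (-1 : k) ^ (i * j) * T Y (S.cst hij (S.comp g g'))

open Classical in
/-- Evaluation of a closed graded trace on a bundled endomorphism of correct
degree (and `0` otherwise). -/
noncomputable def GrTrace.ev {k : Type} [CommRing k] {Obj : Type} {S : DGStr k Obj}
    {n : ℕ} (Tr : GrTrace S n) (x : S.M) : k :=
  if h : x.1 = x.2.1 ∧ x.2.2.1 = n then
    Tr.T x.1 (cast (by
      rw [show S.Hom x.1 x.2.1 x.2.2.1 = S.Hom x.1 x.1 x.2.2.1 from
        congrArg (fun A => S.Hom x.1 A x.2.2.1) h.1.symm]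
      exact congrArg (S.Hom x.1 x.1) h.2) x.2.2.2 : S.Hom x.1 x.1 n)
  else 0

/-- A `k`-linear semifunctor from a semicategory `C` into the degree `0` part
of a DG semicategory `S`. -/
structure SemiFun0 {k : Type} [CommRing k] (C : SemiCat k) {Obj' : Type}
    (S : DGStr k Obj') where
  obj : C.Obj → Obj'
  map : ∀ {X Y : C.Obj}, C.Hom X Y → S.Hom (obj X) (obj Y) 0
  map_add : ∀ {X Y} (f g : C.Hom X Y), map (f + g) = map f + map g
  map_smul : ∀ {X Y} (c : k) (f : C.Hom X Y), map (c • f) = c • map f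
  map_comp : ∀ {X Y Z} (g : C.Hom Y Z) (f : C.Hom X Y),
    map (C.comp g f) = S.comp (map g) (map f)

namespace SemiFun0

variable {k : Type} [CommRing k] {C : SemiCat k} {Obj' : Type} {S : DGStr k Obj'}

/-- Image of a bundled morphism. -/
def sig (ρ : SemiFun0 C S) (x : C.M) : S.M := ⟨ρ.obj x.1, ρ.obj x.2.1, 0, ρ.map x.2.2⟩

end SemiFun0

/-- The character of the `n`-dimensional cycle `(S, d, Tr, ρ)` over the
category `D`, as a function on degree `n` tuples:
`(f⁰,…,fⁿ) ↦ Tr(ρ(f⁰) ∂(ρ f¹) ⋯ ∂(ρ fⁿ))`. -/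
noncomputable def cycleChar {k : Type} [CommRing k] (D : LinCat k) {Obj' : Type}
    {S : DGStr k Obj'} {n : ℕ} (Tr : GrTrace S n) (ρ : SemiFun0 D.toSemiCat S) :
    D.Tup n → k :=
  fun F => Tr.ev (S.prodM (ρ.sig (F 0))
    (((List.finRange n).map fun l => S.dM (ρ.sig (F ⟨l.val + 1, by omega⟩)))))

/-- `φ` is the character of the given `n`-dimensional cycle over `D` (they agree
on cyclically composable tuples, which determine the corresponding functionals
on the cyclic nerve). -/
noncomputable def IsCharOf {k : Type} [CommRing k] (D : LinCat k) {Obj' : Type}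
    {n : ℕ} (S : DGStr k Obj') (Tr : GrTrace S n) (ρ : SemiFun0 D.toSemiCat S)
    (φ : D.Tup n → k) : Prop :=
  ∀ F : D.Tup n, D.IsCyc F → φ F = cycleChar D Tr ρ F

section SOperator

variable {k : Type} [CommRing k] (D : LinCat k) {Obj' : Type} {S : DGStr k Obj'}

/-- The `j`-th term of the image of the periodicity operator applied to the
character of an `r`-dimensional cycle `(S, Tr, ρ)`:
`T̂(ρf⁰ ∂ρf¹ ⋯ ∂ρf^{j-1} (ρf^j ρf^{j+1}) ∂ρf^{j+2} ⋯ ∂ρf^{r+2})`. -/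
noncomputable def sCharTerm {r : ℕ} (Tr : GrTrace S r) (ρ : SemiFun0 D.toSemiCat S)
    (j : ℕ) (F : D.Tup (r + 2)) : k :=
  Tr.ev (S.prodM (ρ.sig (F 0)) ((List.finRange (r + 2)).filterMap fun l =>
    if l.val + 1 = j + 1 then none
    else if l.val + 1 = j then
      some (S.sc (ρ.sig (F ⟨min j (r + 1), by omega⟩))
        (ρ.sig (F ⟨min (j + 1) (r + 2), by omega⟩)))
    else some (S.dM (ρ.sig (F ⟨l.val + 1, by omega⟩)))))

/-- The image `S(φ)` of the character `φ` of the `r`-dimensional cycle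
`(S, Tr, ρ)` under the periodicity operator (Lemma `Sform`):
`(Sφ)(f⁰ ⊗ … ⊗ f^{r+2}) = ∑_{j=1}^{r+1} T̂(ρf⁰ ∂ρf¹ ⋯ (ρf^j ρf^{j+1}) ⋯ ∂ρf^{r+2})`. -/
noncomputable def sCharOp {r : ℕ} (Tr : GrTrace S r) (ρ : SemiFun0 D.toSemiCat S)
    (F : D.Tup (r + 2)) : k :=
  ∑ j ∈ Finset.Icc 1 (r + 1), sCharTerm D Tr ρ j F

/-- The cochain `ψ(f⁰ ⊗ … ⊗ f^{r+1}) = ∑_{j=1}^{r+1} (-1)^{j-1}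
T̂(ρf⁰ ∂ρf¹ ⋯ ∂ρf^{j-1} · ρf^j · ∂ρf^{j+1} ⋯ ∂ρf^{r+1})`. -/
noncomputable def sPsi {r : ℕ} (Tr : GrTrace S r) (ρ : SemiFun0 D.toSemiCat S)
    (F : D.Tup (r + 1)) : k :=
  ∑ j ∈ Finset.Icc 1 (r + 1), (-1 : k) ^ (j - 1) *
    Tr.ev (S.prodM (ρ.sig (F 0)) ((List.finRange (r + 1)).map fun l =>
      if l.val + 1 = j then ρ.sig (F ⟨l.val + 1, by omega⟩)
      else S.dM (ρ.sig (F ⟨l.val + 1, by omega⟩))))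

end SOperator

namespace DGStr

variable {k : Type} [CommRing k] {Obj : Type} (S : DGStr k Obj)

open Classical in
/-- Sum of two bundled morphisms with the same endpoints and degree
(junk otherwise). -/
noncomputable def saddM (x y : S.M) : S.M :=
  if h : y.1 = x.1 ∧ y.2.1 = x.2.1 ∧ y.2.2.1 = x.2.2.1 then
    ⟨x.1, x.2.1, x.2.2.1, x.2.2.2 + cast
      (((congrArg (fun A => S.Hom A y.2.1 y.2.2.1) h.1).trans
        (congrArg (fun B => S.Hom x.1 B y.2.2.1) h.2.1)).trans
        (congrArg (S.Hom x.1 x.2.1) h.2.2)) y.2.2.2⟩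
  else x

/-- Scalar multiple of a bundled morphism. -/
def smulM (c : k) (x : S.M) : S.M := ⟨x.1, x.2.1, x.2.2.1, c • x.2.2.2⟩

end DGStr


attribute [reducible] SemiCat.M LinCat.Tup DGStr.M

namespace SemiCat

variable {k : Type} [CommRing k] (D : SemiCat k)

lemma comp_zero {X Y Z : D.Obj} (g : D.Hom Y Z) : D.comp g (0 : D.Hom X Y) = 0 := by
  simpa using D.comp_smul_right (0 : k) g (0 : D.Hom X Y)

lemma zero_comp {X Y Z : D.Obj} (f : D.Hom X Y) : D.comp (0 : D.Hom Y Z) f = 0 := by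
  simpa using D.comp_smul_left (0 : k) (0 : D.Hom Y Z) f

lemma sc_mk {A B E : D.Obj} (g : D.Hom B E) (f : D.Hom A B) :
    D.sc ⟨B, E, g⟩ ⟨A, B, f⟩ = ⟨A, E, D.comp g f⟩ := by
  simp [sc]

lemma sc_of_ne {x y : D.M} (h : y.2.1 ≠ x.1) : D.sc x y = ⟨y.1, x.2.1, 0⟩ := by
  simp [sc, h]

@[simp] lemma sc_fst (x y : D.M) : (D.sc x y).1 = y.1 := by
  by_cases h : y.2.1 = x.1
  · rw [sc, dif_pos h]
  · rw [sc, dif_neg h]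

@[simp] lemma sc_snd_fst (x y : D.M) : (D.sc x y).2.1 = x.2.1 := by
  by_cases h : y.2.1 = x.1
  · rw [sc, dif_pos h]
  · rw [sc, dif_neg h]

lemma mk_zero_congr {A A' B B' : D.Obj} (hA : A = A') (hB : B = B') :
    (⟨A, B, 0⟩ : D.M) = ⟨A', B', 0⟩ := by
  subst hA hB; rfl

lemma sc_zero (x : D.M) (A B : D.Obj) : D.sc x ⟨A, B, 0⟩ = ⟨A, x.2.1, 0⟩ := by
  by_cases h : B = x.1
  · obtain ⟨X, Y, f⟩ := x
    subst h
    rw [sc_mk, comp_zero]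
  · exact D.sc_of_ne h

lemma zero_sc (x : D.M) (A B : D.Obj) : D.sc ⟨A, B, 0⟩ x = ⟨x.1, B, 0⟩ := by
  by_cases h : x.2.1 = A
  · obtain ⟨X, Y, f⟩ := x
    subst h
    rw [sc_mk, zero_comp]
  · exact D.sc_of_ne h

lemma sc_assoc (x y z : D.M) : D.sc (D.sc x y) z = D.sc x (D.sc y z) := by
  by_cases hxy : y.2.1 = x.1
  · by_cases hyz : z.2.1 = y.1
    · obtain ⟨X, X', f⟩ := x
      obtain ⟨Y, Y', g⟩ := y
      obtain ⟨Z, Z', h⟩ := z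
      dsimp only at hxy hyz
      subst hxy hyz
      simp only [sc_mk, D.comp_assoc]
    · rw [D.sc_of_ne hyz, sc_zero, D.sc_of_ne (by simpa using hyz)]
      exact D.mk_zero_congr rfl (by simp)
  · rw [D.sc_of_ne hxy, zero_sc, D.sc_of_ne (by simpa using hxy)]
    exact D.mk_zero_congr (by simp) rfl

/-- `z = c • x + y`, for bundled morphisms with the same endpoints. -/
def IsLin (c : k) (x y z : D.M) : Prop :=
  ∃ (A B : D.Obj) (f g : D.Hom A B), x = ⟨A, B, f⟩ ∧ y = ⟨A, B, g⟩ ∧ z = ⟨A, B, c • f + g⟩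

variable {D}

lemma IsLin.sc_left {c : k} {x y z : D.M} (h : D.IsLin c x y z) (w : D.M) :
    D.IsLin c (D.sc w x) (D.sc w y) (D.sc w z) := by
  obtain ⟨A, B, f, g, rfl, rfl, rfl⟩ := h
  by_cases hw : B = w.1
  · obtain ⟨X, Y, u⟩ := w
    subst hw
    exact ⟨A, Y, D.comp u f, D.comp u g, D.sc_mk _ _, D.sc_mk _ _, by
      rw [sc_mk, D.comp_add_right, D.comp_smul_right]⟩
  · exact ⟨A, w.2.1, 0, 0, D.sc_of_ne hw, D.sc_of_ne hw, by
      rw [D.sc_of_ne hw, smul_zero, add_zero]⟩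

lemma IsLin.sc_right {c : k} {x y z : D.M} (h : D.IsLin c x y z) (w : D.M) :
    D.IsLin c (D.sc x w) (D.sc y w) (D.sc z w) := by
  obtain ⟨A, B, f, g, rfl, rfl, rfl⟩ := h
  by_cases hw : w.2.1 = A
  · obtain ⟨X, Y, u⟩ := w
    subst hw
    exact ⟨X, B, D.comp f u, D.comp g u, D.sc_mk _ _, D.sc_mk _ _, by
      rw [sc_mk, D.comp_add_left, D.comp_smul_left]⟩
  · exact ⟨w.1, B, 0, 0, D.sc_of_ne hw, D.sc_of_ne hw, by
      rw [D.sc_of_ne hw, smul_zero, add_zero]⟩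

lemma IsLin.fst_eq {c : k} {x y z : D.M} (h : D.IsLin c x y z) :
    x.1 = z.1 ∧ y.1 = z.1 ∧ x.2.1 = z.2.1 ∧ y.2.1 = z.2.1 := by
  obtain ⟨A, B, f, g, rfl, rfl, rfl⟩ := h
  exact ⟨rfl, rfl, rfl, rfl⟩

end SemiCat

namespace LinCat

variable {k : Type} [CommRing k] (D : LinCat k) {n : ℕ}

/-- `H` is obtained from `F` and `G` by taking `c • f + g` in one slot, all the other
slots being the same. -/
def IsLinTup (c : k) (F G H : D.Tup n) : Prop :=
  ∃ i, D.toSemiCat.IsLin c (F i) (G i) (H i) ∧ ∀ j, j ≠ i → F j = H j ∧ G j = H j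

lemma isCochain_iff (φ : D.Tup n → k) :
    D.IsCochain φ ↔
      (∀ c F G H, D.IsLinTup c F G H → φ H = c * φ F + φ G) ∧ ∀ F, ¬ D.IsCyc F → φ F = 0 := by
  constructor
  · refine fun hφ => ⟨?_, hφ.supported⟩
    rintro c F G H ⟨i, hi, hj⟩
    obtain ⟨f, g, hF, hG, hH⟩ : ∃ f g : D.Hom (H i).1 (H i).2.1,
        F i = ⟨_, _, f⟩ ∧ G i = ⟨_, _, g⟩ ∧ H i = ⟨_, _, c • f + g⟩ := by
      obtain ⟨A, B, f, g, hF, hG, hH⟩ := hi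
      rw [hF, hG]
      clear hF hG
      generalize H i = z at hH ⊢
      subst hH
      exact ⟨f, g, rfl, rfl, rfl⟩
    have key : ∀ (K : D.Tup n) (f : D.Hom (H i).1 (H i).2.1), K i = ⟨_, _, f⟩ →
        (∀ j, j ≠ i → K j = H j) → K = D.upd H i f := by
      intro K f hK hK'
      funext j
      by_cases h : j = i
      · subst h; simp [upd, hK]
      · simp [upd, h, hK' j h]
    rw [key F f hF fun j h => (hj j h).1, key G g hG fun j h => (hj j h).2,
      ← hφ.map_smul, ← hφ.map_add, ← key H _ hH fun _ _ => rfl]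
  · rintro ⟨hl, hs⟩
    have lin : ∀ (F : D.Tup n) (i : Fin (n + 1)) (c : k) (f g : D.Hom (F i).1 (F i).2.1),
        φ (D.upd F i (c • f + g)) = c * φ (D.upd F i f) + φ (D.upd F i g) := by
      refine fun F i c f g => hl _ _ _ _ ⟨i, ⟨_, _, f, g, ?_, ?_, ?_⟩, fun j h => ?_⟩ <;>
        simp [upd, *]
    have zero : ∀ (F : D.Tup n) (i : Fin (n + 1)), φ (D.upd F i 0) = 0 := by
      intro F i
      simpa using lin F i 1 0 0
    exact ⟨fun F i f g => by simpa using lin F i 1 f g,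
      fun F i c f => by simpa [zero] using lin F i c f 0, hs⟩

lemma IsCochain.eq_zero {φ : D.Tup n → k} (hφ : D.IsCochain φ) {F : D.Tup n}
    (i : Fin (n + 1)) (A B : D.Obj) (h : F i = ⟨A, B, 0⟩) : φ F = 0 := by
  have := ((D.isCochain_iff φ).1 hφ).1 1 F F F
    ⟨i, ⟨A, B, 0, 0, h, h, by simpa using h⟩, fun _ _ => ⟨rfl, rfl⟩⟩
  simpa using this

/-- The `k`-module `CN^n(D)` of cochains. -/
def cochains (n : ℕ) : Submodule k (D.Tup n → k) where
  carrier := {φ | D.IsCochain φ}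
  add_mem' {φ χ} hφ hχ := by
    rw [Set.mem_ofPred_eq, isCochain_iff] at *
    refine ⟨fun c F G H h => ?_, fun F h => ?_⟩
    · rw [Pi.add_apply, hφ.1 c F G H h, hχ.1 c F G H h, Pi.add_apply, Pi.add_apply]
      ring
    · rw [Pi.add_apply, hφ.2 F h, hχ.2 F h, add_zero]
  zero_mem' := by
    rw [Set.mem_ofPred_eq, isCochain_iff]
    exact ⟨fun _ _ _ _ _ => by simp, fun _ _ => rfl⟩
  smul_mem' a φ hφ := by
    rw [Set.mem_ofPred_eq, isCochain_iff] at *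
    refine ⟨fun c F G H h => ?_, fun F h => ?_⟩
    · simp only [Pi.smul_apply, smul_eq_mul, hφ.1 c F G H h]
      ring
    · rw [Pi.smul_apply, hφ.2 F h, smul_zero]

lemma IsCochain.ext {φ χ : D.Tup n → k} (hφ : D.IsCochain φ) (hχ : D.IsCochain χ)
    (h : ∀ F, D.IsCyc F → φ F = χ F) : φ = χ := by
  funext F
  by_cases hF : D.IsCyc F
  · exact h F hF
  · rw [hφ.supported F hF, hχ.supported F hF]

/-! ### Rotations and faces of tuples -/

/-- The `i`-th face of a tuple, the face of index `n + 1` being the cyclic one. -/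
noncomputable def face (i : ℕ) (F : D.Tup (n + 1)) : D.Tup n :=
  if i ≤ n then D.faceT i F else D.lastFaceT F

lemma rotT_apply (F : D.Tup n) (j : Fin (n + 1)) : D.rotT F j = F (j - 1) := by
  unfold rotT
  split_ifs with h
  · subst h
    congr 1
    rw [zero_sub, eq_neg_iff_add_eq_zero, Fin.last_add_one]
  · rfl

lemma rotT_zero (F : D.Tup n) : D.rotT F 0 = F (Fin.last n) := rfl

lemma rotT_succ (F : D.Tup n) (j : ℕ) (h : j + 1 < n + 1) :
    D.rotT F ⟨j + 1, h⟩ = F ⟨j, by omega⟩ := by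
  rw [rotT_apply]
  congr 1
  ext
  rw [Fin.val_sub_one_of_ne_zero (by simp [Fin.ext_iff])]
  rfl

lemma iterate_rotT_apply (F : D.Tup n) (i : ℕ) (j : Fin (n + 1)) :
    (D.rotT)^[i] F j = F (j - i • (1 : Fin (n + 1))) := by
  induction i generalizing j with
  | zero => simp
  | succ i ih =>
    rw [Function.iterate_succ_apply', rotT_apply, ih, succ_nsmul', sub_sub]

lemma iterate_rotT_self (F : D.Tup n) : (D.rotT)^[n + 1] F = F := by
  funext j
  have h : (n + 1) • (1 : Fin (n + 1)) = 0 := by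
    simpa using card_nsmul_eq_zero' (G := Fin (n + 1)) (x := 1)
  rw [iterate_rotT_apply, h, sub_zero]

lemma isCyc_rotT_iff (F : D.Tup n) : D.IsCyc (D.rotT F) ↔ D.IsCyc F := by
  refine ⟨fun h i => ?_, fun h i => ?_⟩
  · have := h (i + 1)
    rwa [rotT_apply, rotT_apply, add_sub_cancel_right] at this
  · rw [rotT_apply, rotT_apply]
    exact h (i - 1)

lemma isCyc_iff (F : D.Tup n) : D.IsCyc F ↔ (F 0).2.1 = (F (Fin.last n)).1 ∧
    ∀ (i : ℕ) (h : i < n), (F ⟨i + 1, by omega⟩).2.1 = (F ⟨i, by omega⟩).1 := by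
  have h0 : ∀ i : Fin (n + 1), F (i - 1) = D.rotT F i := fun i => (D.rotT_apply F i).symm
  simp only [IsCyc, h0]
  constructor
  · exact fun h => ⟨h 0, fun i hi => (h ⟨i + 1, by omega⟩).trans (by rw [rotT_succ])⟩
  · rintro ⟨h1, h2⟩ ⟨i, hi⟩
    cases i with
    | zero => exact h1
    | succ i => rw [rotT_succ]; exact h2 i (by omega)

lemma faceT_of_lt {i j : ℕ} (F : D.Tup (n + 1)) (hj : j < n + 1) (h : j < i) :
    D.faceT i F ⟨j, hj⟩ = F ⟨j, by omega⟩ := by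
  simp [faceT, h]

lemma faceT_self {i : ℕ} (F : D.Tup (n + 1)) (hi : i < n + 1) :
    D.faceT i F ⟨i, hi⟩ = D.toSemiCat.sc (F ⟨i, by omega⟩) (F ⟨i + 1, by omega⟩) := by
  have h1 : min i (n + 1) = i := by omega
  have h2 : min (i + 1) (n + 1) = i + 1 := by omega
  simp [faceT, h1, h2]

lemma faceT_of_gt {i j : ℕ} (F : D.Tup (n + 1)) (hj : j < n + 1) (h : i < j) :
    D.faceT i F ⟨j, hj⟩ = F ⟨j + 1, by omega⟩ := by
  simp [faceT, h.ne', h.not_gt]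

lemma lastFaceT_zero (F : D.Tup (n + 1)) :
    D.lastFaceT F 0 = D.toSemiCat.sc (F (Fin.last (n + 1))) (F 0) := rfl

lemma lastFaceT_succ {j : ℕ} (F : D.Tup (n + 1)) (hj : j + 1 < n + 1) :
    D.lastFaceT F ⟨j + 1, hj⟩ = F ⟨j + 1, by omega⟩ := by
  simp [lastFaceT]

lemma face_of_le {i : ℕ} (hi : i ≤ n) (F : D.Tup (n + 1)) : D.face i F = D.faceT i F :=
  if_pos hi

lemma face_last (F : D.Tup (n + 1)) : D.face (n + 1) F = D.lastFaceT F :=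
  if_neg (by omega)

lemma face_zero_rotT (F : D.Tup (n + 1)) : D.face 0 (D.rotT F) = D.face (n + 1) F := by
  rw [face_last, face_of_le D (Nat.zero_le n)]
  funext ⟨j, hj⟩
  rcases j with _ | j
  · exact (D.faceT_self _ (Nat.succ_pos n)).trans (by rw [rotT_succ]; rfl)
  · rw [faceT_of_gt D _ _ (Nat.succ_pos j), rotT_succ, lastFaceT_succ]

lemma face_succ_rotT {i : ℕ} (hi : i ≤ n) (F : D.Tup (n + 1)) :
    D.face (i + 1) (D.rotT F) = D.rotT (D.face i F) := by
  rw [face_of_le D hi]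
  rcases hi.lt_or_eq with h | rfl
  · rw [face_of_le D (Nat.succ_le_of_lt h)]
    funext ⟨j, hj⟩
    rcases j with _ | j
    · rw [faceT_of_lt D _ _ (Nat.succ_pos i)]
      exact (D.faceT_of_gt F (Nat.lt_succ_self n) h).symm
    · rw [rotT_succ]
      rcases lt_trichotomy j i with h' | rfl | h'
      · rw [faceT_of_lt D _ _ (by omega), faceT_of_lt D _ _ h', rotT_succ]
      · rw [faceT_self, faceT_self, rotT_succ, rotT_succ]
      · rw [faceT_of_gt D _ _ (by omega), faceT_of_gt D _ _ h', rotT_succ]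
  · rw [face_last]
    funext ⟨j, hj⟩
    rcases j with _ | j
    · have h1 := D.rotT_zero (D.faceT i F)
      have h2 := D.faceT_self F (Nat.lt_succ_self i)
      exact (D.lastFaceT_zero _).trans ((congrArg₂ _ (D.rotT_succ F i (by omega)) rfl).trans
        (h1.trans h2).symm)
    · rw [lastFaceT_succ, rotT_succ, rotT_succ, faceT_of_lt D _ _ (by omega)]

lemma faceT_faceT {i j : ℕ} (hij : i < j) (hj : j ≤ n + 1) (F : D.Tup (n + 2)) :
    D.faceT i (D.faceT j F) = D.faceT (j - 1) (D.faceT i F) := by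
  obtain ⟨j, rfl⟩ : ∃ j', j = j' + 1 := ⟨j - 1, by omega⟩
  rw [Nat.add_sub_cancel]
  funext ⟨l, hl⟩
  rcases lt_trichotomy l i with h | rfl | h
  · rw [faceT_of_lt D _ _ h, faceT_of_lt D _ _ (by omega), faceT_of_lt D _ _ (by omega),
      faceT_of_lt D _ _ h]
  · rw [faceT_self, faceT_of_lt D _ _ hij]
    rcases (Nat.le_of_lt_succ hij).lt_or_eq with h' | rfl
    · rw [faceT_of_lt D _ _ (by omega), faceT_of_lt D _ _ h', faceT_self]
    · rw [faceT_self, faceT_self, faceT_self, faceT_of_gt D _ _ (by omega), SemiCat.sc_assoc]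
  · rw [faceT_of_gt D _ _ h]
    rcases lt_trichotomy l j with h' | rfl | h'
    · rw [faceT_of_lt D _ _ (by omega), faceT_of_lt D _ _ h', faceT_of_gt D _ _ h]
    · rw [faceT_self, faceT_self, faceT_of_gt D _ _ h, faceT_of_gt D _ _ (by omega)]
    · rw [faceT_of_gt D _ _ (by omega), faceT_of_gt D _ _ h', faceT_of_gt D _ _ (by omega)]

lemma face_face {i j : ℕ} (hij : i < j) (hj : j ≤ n + 2) (F : D.Tup (n + 2)) :
    D.face i (D.face j F) = D.face (j - 1) (D.face i F) := by
  rcases hj.lt_or_eq with hj | rfl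
  · rw [face_of_le D (by omega), face_of_le D (by omega), face_of_le D (by omega),
      face_of_le D (by omega), faceT_faceT D hij (by omega)]
  · rw [show n + 2 - 1 = n + 1 from rfl, ← face_zero_rotT D (D.face i F),
      ← face_zero_rotT D F, ← face_succ_rotT D (by omega)]
    rcases (Nat.le_of_lt_succ hij).lt_or_eq with hi | rfl
    · rw [face_of_le D (by omega), face_of_le D (by omega), face_of_le D (by omega),
        face_of_le D (by omega), faceT_faceT D (Nat.succ_pos i) (by omega), Nat.succ_sub_one]
    · rw [← face_zero_rotT, ← face_succ_rotT D (by omega), ← face_zero_rotT D (D.rotT F),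
        face_of_le D (by omega), face_of_le D (by omega), face_of_le D (by omega),
        faceT_faceT D Nat.zero_lt_one (by omega), face_of_le D (by omega), Nat.sub_self]

variable {D} in
lemma IsLinTup.rotT {c : k} {F G H : D.Tup n} (h : D.IsLinTup c F G H) :
    D.IsLinTup c (D.rotT F) (D.rotT G) (D.rotT H) := by
  obtain ⟨i, hi, h⟩ := h
  refine ⟨i + 1, ?_, fun j hj => ?_⟩
  · simpa only [rotT_apply, add_sub_cancel_right] using hi
  · simp only [rotT_apply]
    exact h _ fun h' => hj (by rw [← h', sub_add_cancel])

variable {D} in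
lemma IsLinTup.faceT {c : k} {F G H : D.Tup (n + 1)} (h : D.IsLinTup c F G H) {i : ℕ}
    (hi : i ≤ n) : D.IsLinTup c (D.faceT i F) (D.faceT i G) (D.faceT i H) := by
  obtain ⟨⟨l, hl⟩, hlin, h⟩ := h
  have h' : ∀ (j : ℕ) (hj : j < n + 2), j ≠ l → F ⟨j, hj⟩ = H ⟨j, hj⟩ ∧ G ⟨j, hj⟩ = H ⟨j, hj⟩ :=
    fun j hj hjl => h _ (by simpa [Fin.ext_iff] using hjl)
  refine ⟨⟨if l ≤ i then l else l - 1, by split_ifs <;> omega⟩, ?_, ?_⟩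
  · split_ifs with hli
    · rcases hli.lt_or_eq with hli | rfl
      · simpa only [faceT_of_lt D _ _ hli] using hlin
      · rw [faceT_self, faceT_self, faceT_self, (h' (l + 1) (by omega) (by omega)).1,
          (h' (l + 1) (by omega) (by omega)).2]
        exact hlin.sc_right _
    · obtain ⟨l, rfl⟩ : ∃ l', l = l' + 1 := ⟨l - 1, by omega⟩
      simp only [Nat.add_sub_cancel]
      rcases (show i ≤ l by omega).lt_or_eq with hil | rfl
      · simpa only [faceT_of_gt D _ _ hil] using hlin
      · rw [faceT_self, faceT_self, faceT_self, (h' i (by omega) (by omega)).1,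
          (h' i (by omega) (by omega)).2]
        exact hlin.sc_left _
  · rintro ⟨j, hj⟩ hjl
    have hjl : j ≠ if l ≤ i then l else l - 1 := by simpa [Fin.ext_iff] using hjl
    rcases lt_trichotomy j i with hji | rfl | hji
    · simp only [faceT_of_lt D _ _ hji]
      exact h' _ _ (by split_ifs at hjl <;> omega)
    · have h1 := h' j (by omega) (by split_ifs at hjl <;> omega)
      have h2 := h' (j + 1) (by omega) (by split_ifs at hjl <;> omega)
      simp only [faceT_self, h1.1, h1.2, h2.1, h2.2, and_self]
    · simp only [faceT_of_gt D _ _ hji]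
      exact h' _ _ (by split_ifs at hjl <;> omega)

lemma face_eq_faceT_or {i : ℕ} (hi : i ≤ n + 1) : (i ≤ n ∧ ∀ F : D.Tup (n + 1),
    D.face i F = D.faceT i F) ∨ ∀ F : D.Tup (n + 1), D.face i F = D.faceT 0 (D.rotT F) := by
  rcases hi.lt_or_eq with hi | rfl
  · exact Or.inl ⟨by omega, fun F => D.face_of_le (by omega) F⟩
  · exact Or.inr fun F => by rw [← face_zero_rotT, face_of_le D (Nat.zero_le n)]

variable {D} in
lemma IsLinTup.face {c : k} {F G H : D.Tup (n + 1)} (h : D.IsLinTup c F G H) {i : ℕ}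
    (hi : i ≤ n + 1) : D.IsLinTup c (D.face i F) (D.face i G) (D.face i H) := by
  rcases D.face_eq_faceT_or hi with ⟨hi, hf⟩ | hf
  · rw [hf, hf, hf]; exact h.faceT hi
  · rw [hf, hf, hf]; exact h.rotT.faceT (Nat.zero_le n)

lemma isCyc_faceT_iff {i : ℕ} (hi : i ≤ n) {F : D.Tup (n + 1)}
    (h : (F ⟨i + 1, by omega⟩).2.1 = (F ⟨i, by omega⟩).1) :
    D.IsCyc (D.faceT i F) ↔ D.IsCyc F := by
  have dom : ∀ (j : ℕ) (hj : j < n + 1), (D.faceT i F ⟨j, hj⟩).1 =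
      if j < i then (F ⟨j, by omega⟩).1 else (F ⟨j + 1, by omega⟩).1 := by
    intro j hj
    rcases lt_trichotomy j i with hji | rfl | hji
    · rw [if_pos hji, faceT_of_lt D _ _ hji]
    · rw [if_neg (lt_irrefl _), faceT_self, SemiCat.sc_fst]
    · rw [if_neg hji.not_gt, faceT_of_gt D _ _ hji]
  have cod : ∀ (j : ℕ) (hj : j < n + 1), (D.faceT i F ⟨j, hj⟩).2.1 =
      if j ≤ i then (F ⟨j, by omega⟩).2.1 else (F ⟨j + 1, by omega⟩).2.1 := by
    intro j hj
    rcases lt_trichotomy j i with hji | rfl | hji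
    · rw [if_pos hji.le, faceT_of_lt D _ _ hji]
    · rw [if_pos le_rfl, faceT_self, SemiCat.sc_snd_fst]
    · rw [if_neg hji.not_ge, faceT_of_gt D _ _ hji]
  rw [isCyc_iff, isCyc_iff]
  have h0 := cod 0 (Nat.succ_pos n)
  have hn := dom n (Nat.lt_succ_self n)
  rw [if_pos (Nat.zero_le i)] at h0
  rw [if_neg (by omega)] at hn
  refine and_congr (Eq.congr h0 hn) ⟨fun H j hj => ?_, fun H j hj => ?_⟩
  · rcases lt_trichotomy j i with hji | rfl | hji
    · have := H j (by omega)
      rwa [cod, dom, if_pos (by omega), if_pos hji] at this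
    · exact h
    · obtain ⟨j, rfl⟩ : ∃ j', j = j' + 1 := ⟨j - 1, by omega⟩
      have := H j (by omega)
      rwa [cod, dom, if_neg (by omega), if_neg (by omega)] at this
  · rw [cod, dom]
    rcases lt_or_ge j i with hji | hji
    · rw [if_pos (by omega), if_pos hji]
      exact H j (by omega)
    · rw [if_neg (by omega), if_neg (by omega)]
      exact H (j + 1) (by omega)

lemma isCyc_face {i : ℕ} (hi : i ≤ n + 1) {F : D.Tup (n + 1)} (h : D.IsCyc F) :
    D.IsCyc (D.face i F) := by
  rcases D.face_eq_faceT_or hi with ⟨hi, hf⟩ | hf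
  · rw [hf, isCyc_faceT_iff D hi (((D.isCyc_iff F).1 h).2 i (by omega))]
    exact h
  · have h := (D.isCyc_rotT_iff F).2 h
    rw [hf, isCyc_faceT_iff D (Nat.zero_le n) (((D.isCyc_iff _).1 h).2 0 (by omega))]
    exact h

variable {D} in
lemma IsCochain.apply_faceT {φ : D.Tup n → k} (hφ : D.IsCochain φ) {i : ℕ} (hi : i ≤ n)
    {F : D.Tup (n + 1)} (h : ¬ D.IsCyc F) : φ (D.faceT i F) = 0 := by
  by_cases hF : (F ⟨i + 1, by omega⟩).2.1 = (F ⟨i, by omega⟩).1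
  · exact hφ.supported _ (by rwa [isCyc_faceT_iff D hi hF])
  · exact hφ.eq_zero D ⟨i, by omega⟩ (F ⟨i + 1, by omega⟩).1 (F ⟨i, by omega⟩).2.1
      ((D.faceT_self F _).trans (D.toSemiCat.sc_of_ne hF))

variable {D} in
lemma IsCochain.comp_face {φ : D.Tup n → k} (hφ : D.IsCochain φ) {i : ℕ} (hi : i ≤ n + 1) :
    D.IsCochain fun F => φ (D.face i F) := by
  rw [isCochain_iff]
  refine ⟨fun c F G H h => ((D.isCochain_iff φ).1 hφ).1 c _ _ _ (h.face hi), fun F h => ?_⟩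
  rcases D.face_eq_faceT_or hi with ⟨hi, hf⟩ | hf
  · rw [hf]; exact hφ.apply_faceT hi h
  · rw [hf]; exact hφ.apply_faceT (Nat.zero_le n) (by rwa [isCyc_rotT_iff])

variable {D} in
lemma IsCochain.comp_rotT {φ : D.Tup n → k} (hφ : D.IsCochain φ) :
    D.IsCochain fun F => φ (D.rotT F) := by
  rw [isCochain_iff]
  exact ⟨fun c F G H h => ((D.isCochain_iff φ).1 hφ).1 c _ _ _ h.rotT,
    fun F h => hφ.supported _ (by rwa [isCyc_rotT_iff])⟩

/-! ### Inserting identities -/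

lemma snocIdT_of_lt {j : ℕ} (F : D.Tup n) (hj : j < n + 1) :
    D.snocIdT F ⟨j, by omega⟩ = F ⟨j, hj⟩ := by
  have : j ≤ n := by omega
  simp [snocIdT, this]

lemma snocIdT_last (F : D.Tup n) : D.snocIdT F (Fin.last (n + 1)) = D.idM (F 0).2.1 := by
  simp [snocIdT]

lemma rotT_snocIdT (F : D.Tup n) : D.rotT (D.snocIdT F) = D.consIdT F := by
  funext ⟨j, hj⟩
  rcases j with _ | j
  · exact (D.rotT_zero _).trans (D.snocIdT_last F)
  · rw [rotT_succ, snocIdT_of_lt D F (by omega)]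
    simp [consIdT]

lemma isCyc_snocIdT_iff (F : D.Tup n) : D.IsCyc (D.snocIdT F) ↔ D.IsCyc F := by
  have h0 : D.snocIdT F 0 = F 0 := D.snocIdT_of_lt F (Nat.succ_pos n)
  rw [isCyc_iff, isCyc_iff, snocIdT_last, h0]
  constructor
  · rintro ⟨-, h⟩
    refine ⟨?_, fun i hi => ?_⟩
    · have := h n (by omega)
      rw [snocIdT_of_lt D F (Nat.lt_succ_self n)] at this
      rw [← show _ = (F (Fin.last n)).1 from this]
      exact (congrArg (·.2.1) (D.snocIdT_last F)).symm
    · have := h i (by omega)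
      rwa [snocIdT_of_lt D F (by omega), snocIdT_of_lt D F (by omega)] at this
  · rintro ⟨h1, h2⟩
    refine ⟨rfl, fun i hi => ?_⟩
    rw [snocIdT_of_lt D F hi]
    rcases (Nat.le_of_lt_succ hi).lt_or_eq with hi' | rfl
    · rw [snocIdT_of_lt D F (by omega)]
      exact h2 i hi'
    · exact (congrArg (·.2.1) (D.snocIdT_last F)).trans h1

lemma face_snocIdT {i : ℕ} (hi : i ≤ n) (F : D.Tup (n + 1)) :
    D.face i (D.snocIdT F) = D.snocIdT (D.face i F) := by
  rw [face_of_le D (by omega), face_of_le D hi]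
  funext ⟨j, hj⟩
  rcases (Nat.le_of_lt_succ hj).lt_or_eq with hj' | rfl
  · rw [snocIdT_of_lt D _ hj']
    rcases lt_trichotomy j i with h | rfl | h
    · rw [faceT_of_lt D _ _ h, faceT_of_lt D _ _ h, snocIdT_of_lt D _ (by omega)]
    · rw [faceT_self, faceT_self, snocIdT_of_lt D _ (by omega), snocIdT_of_lt D _ (by omega)]
    · rw [faceT_of_gt D _ _ h, faceT_of_gt D _ _ h, snocIdT_of_lt D _ (by omega)]
  · rw [faceT_of_gt D _ _ (by omega)]
    refine (D.snocIdT_last F).trans (Eq.trans ?_ (D.snocIdT_last _).symm)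
    congr 1
    rcases Nat.eq_zero_or_pos i with rfl | h
    · exact (D.toSemiCat.sc_snd_fst _ _).symm.trans
        (congrArg (·.2.1) (D.faceT_self F (Nat.succ_pos n)).symm)
    · exact congrArg (·.2.1) (D.faceT_of_lt F (Nat.succ_pos n) h).symm

lemma face_snocIdT_self {F : D.Tup n} (h : D.IsCyc F) : D.face n (D.snocIdT F) = F := by
  rw [face_of_le D le_rfl]
  funext ⟨j, hj⟩
  rcases (Nat.le_of_lt_succ hj).lt_or_eq with hj' | rfl
  · rw [faceT_of_lt D _ _ hj', snocIdT_of_lt D _ (by omega)]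
  · rw [faceT_self, snocIdT_of_lt D _ hj]
    have hX : (F 0).2.1 = (F ⟨j, hj⟩).1 := ((D.isCyc_iff F).1 h).1
    refine (congrArg₂ _ rfl (D.snocIdT_last F)).trans ?_
    rw [hX]
    generalize F ⟨j, hj⟩ = x
    obtain ⟨X, Y, f⟩ := x
    exact (D.toSemiCat.sc_mk f (D.id X)).trans (by rw [D.comp_id])

variable {D} in
lemma IsLinTup.snocIdT {c : k} {F G H : D.Tup n} (h : D.IsLinTup c F G H) :
    D.IsLinTup c (D.snocIdT F) (D.snocIdT G) (D.snocIdT H) := by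
  obtain ⟨⟨i, hi⟩, hlin, h⟩ := h
  refine ⟨⟨i, by omega⟩, by simpa only [snocIdT_of_lt D _ hi] using hlin, ?_⟩
  rintro ⟨j, hj⟩ hij
  have hij : j ≠ i := by simpa [Fin.ext_iff] using hij
  rcases (Nat.le_of_lt_succ hj).lt_or_eq with hj' | rfl
  · simp only [snocIdT_of_lt D _ hj']
    exact h _ (by simpa [Fin.ext_iff] using hij)
  · have h0 : (F 0).2.1 = (H 0).2.1 ∧ (G 0).2.1 = (H 0).2.1 := by
      rcases Nat.eq_zero_or_pos i with rfl | hpos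
      · exact hlin.fst_eq.2.2
      · have := h 0 (by simpa [Fin.ext_iff] using hpos.ne)
        rw [this.1, this.2]; exact ⟨rfl, rfl⟩
    have e := D.snocIdT_last (n := n)
    exact ⟨(e F).trans ((congrArg D.idM h0.1).trans (e H).symm),
      (e G).trans ((congrArg D.idM h0.2).trans (e H).symm)⟩

variable {D} in
lemma IsCochain.comp_snocIdT {φ : D.Tup (n + 1) → k} (hφ : D.IsCochain φ) :
    D.IsCochain fun F => φ (D.snocIdT F) := by
  rw [isCochain_iff]
  exact ⟨fun c F G H h => ((D.isCochain_iff φ).1 hφ).1 c _ _ _ h.snocIdT,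
    fun F h => hφ.supported _ (by rwa [isCyc_snocIdT_iff])⟩

/-! ### The operators as linear maps -/

/-- The signed coface operator `(-1)^i δ_i` as a linear map. -/
noncomputable def coface (i : ℕ) : (D.Tup n → k) →ₗ[k] (D.Tup (n + 1) → k) :=
  (-1 : k) ^ i • LinearMap.funLeft k k (D.face i)

lemma coface_apply (i : ℕ) (φ : D.Tup n → k) (F : D.Tup (n + 1)) :
    D.coface i φ F = (-1) ^ i * φ (D.face i F) := rfl

/-- The signed cyclic operator as an endomorphism. -/
def lamEnd (n : ℕ) : Module.End k (D.Tup n → k) :=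
  (-1 : k) ^ n • LinearMap.funLeft k k D.rotT

lemma lamEnd_apply (φ : D.Tup n → k) : D.lamEnd n φ = D.lamOp φ := rfl

lemma lamEnd_apply_apply (φ : D.Tup n → k) (F : D.Tup n) :
    D.lamEnd n φ F = (-1) ^ n * φ (D.rotT F) := rfl

lemma lamEnd_pow_apply_apply (i : ℕ) (φ : D.Tup n → k) (F : D.Tup n) :
    (D.lamEnd n ^ i) φ F = (-1) ^ (n * i) * φ (D.rotT^[i] F) := by
  induction i generalizing F with
  | zero => simp
  | succ i ih =>
    rw [pow_succ', Module.End.mul_apply, lamEnd_apply_apply, ih, ← Function.iterate_succ_apply]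
    ring

lemma lamEnd_pow_succ_self : D.lamEnd n ^ (n + 1) = 1 := by
  ext φ F
  rw [lamEnd_pow_apply_apply, iterate_rotT_self, (Nat.even_mul_succ_self n).neg_one_pow, one_mul,
    Module.End.one_apply]

/-- The norm operator as an endomorphism. -/
def normEnd (n : ℕ) : Module.End k (D.Tup n → k) :=
  ∑ i ∈ Finset.range (n + 1), D.lamEnd n ^ i

lemma normEnd_apply (φ : D.Tup n → k) : D.normEnd n φ = D.AOp φ := by
  funext F
  rw [normEnd, LinearMap.sum_apply, Finset.sum_apply, AOp]
  refine Finset.sum_congr rfl fun i _ => ?_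
  rw [Module.End.pow_apply]
  rfl

lemma lamEnd_normEnd (φ : D.Tup n → k) : D.lamEnd n (D.normEnd n φ) = D.normEnd n φ := by
  have h := mul_geom_sum (D.lamEnd n) (n + 1)
  rw [lamEnd_pow_succ_self, sub_self, sub_mul, one_mul, sub_eq_zero] at h
  exact LinearMap.congr_fun h φ

lemma normEnd_lamEnd (φ : D.Tup n → k) : D.normEnd n (D.lamEnd n φ) = D.normEnd n φ := by
  have h := geom_sum_mul (D.lamEnd n) (n + 1)
  rw [lamEnd_pow_succ_self, sub_self, mul_sub, mul_one, sub_eq_zero] at h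
  exact LinearMap.congr_fun h φ

lemma lamEnd_pow_eq_self {φ : D.Tup n → k} (h : D.lamEnd n φ = φ) (i : ℕ) :
    (D.lamEnd n ^ i) φ = φ := by
  induction i with
  | zero => rfl
  | succ i ih => rw [pow_succ, Module.End.mul_apply, h, ih]

lemma normEnd_eq_smul {φ : D.Tup n → k} (h : D.lamEnd n φ = φ) :
    D.normEnd n φ = (n + 1) • φ := by
  rw [normEnd, LinearMap.sum_apply,
    Finset.sum_congr rfl fun i _ => D.lamEnd_pow_eq_self h i, Finset.sum_const, Finset.card_range]

/-- The Hochschild coboundary as a linear map. -/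
noncomputable def hochschild (n : ℕ) : (D.Tup n → k) →ₗ[k] (D.Tup (n + 1) → k) :=
  ∑ i ∈ Finset.range (n + 2), D.coface i

/-- The truncated Hochschild coboundary as a linear map. -/
noncomputable def hochschildTrunc (n : ℕ) : (D.Tup n → k) →ₗ[k] (D.Tup (n + 1) → k) :=
  ∑ i ∈ Finset.range (n + 1), D.coface i

lemma hochschild_apply (φ : D.Tup n → k) : D.hochschild n φ = D.bOp φ := by
  funext F
  rw [hochschild, LinearMap.sum_apply, Finset.sum_apply, bOp, ← Fin.sum_univ_eq_sum_range
    (fun i => D.coface i φ F)]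
  refine Finset.sum_congr rfl fun i _ => ?_
  rw [coface_apply, deltaOp, face]
  split_ifs <;> rfl

lemma hochschild_eq_trunc_add (φ : D.Tup n → k) :
    D.hochschild n φ = D.hochschildTrunc n φ + D.coface (n + 1) φ := by
  rw [hochschild, Finset.sum_range_succ]
  rfl

lemma lamEnd_coface_zero (φ : D.Tup n → k) :
    D.lamEnd (n + 1) (D.coface 0 φ) = D.coface (n + 1) φ := by
  funext F
  rw [lamEnd_apply_apply, coface_apply, coface_apply, face_zero_rotT, pow_zero, one_mul]

lemma lamEnd_coface_succ {i : ℕ} (hi : i ≤ n) (φ : D.Tup n → k) :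
    D.lamEnd (n + 1) (D.coface (i + 1) φ) = D.coface i (D.lamEnd n φ) := by
  funext F
  rw [lamEnd_apply_apply, coface_apply, coface_apply, lamEnd_apply_apply, face_succ_rotT D hi]
  ring

lemma lamEnd_hochschild (φ : D.Tup n → k) :
    D.lamEnd (n + 1) (D.hochschild n φ) =
      D.hochschildTrunc n (D.lamEnd n φ) + D.coface (n + 1) φ := by
  rw [hochschild, Finset.sum_range_succ', LinearMap.add_apply, LinearMap.sum_apply, map_add,
    map_sum, lamEnd_coface_zero, hochschildTrunc, LinearMap.sum_apply]
  congr 1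
  exact Finset.sum_congr rfl fun i hi =>
    D.lamEnd_coface_succ (Nat.le_of_lt_succ (Finset.mem_range.1 hi)) φ

lemma hochschild_sub_lamEnd (φ : D.Tup n → k) :
    D.hochschild n φ - D.lamEnd (n + 1) (D.hochschild n φ) =
      D.hochschildTrunc n (φ - D.lamEnd n φ) := by
  rw [lamEnd_hochschild, hochschild_eq_trunc_add, map_sub]
  abel

lemma normEnd_coface {i : ℕ} (hi : i ≤ n) (φ : D.Tup n → k) :
    D.normEnd (n + 1) (D.coface i φ) = D.normEnd (n + 1) (D.coface 0 ((D.lamEnd n ^ i) φ)) := by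
  induction i generalizing φ with
  | zero => rfl
  | succ i ih =>
    rw [← normEnd_lamEnd, lamEnd_coface_succ D (by omega), ih (by omega), pow_succ,
      Module.End.mul_apply]

lemma normEnd_hochschildTrunc (φ : D.Tup n → k) :
    D.normEnd (n + 1) (D.hochschildTrunc n φ) =
      D.normEnd (n + 1) (D.coface 0 (D.normEnd n φ)) := by
  have h : D.normEnd n φ = ∑ i ∈ Finset.range (n + 1), (D.lamEnd n ^ i) φ := by
    rw [normEnd, LinearMap.sum_apply]
  rw [h, hochschildTrunc, LinearMap.sum_apply, map_sum, map_sum, map_sum]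
  exact Finset.sum_congr rfl fun i hi =>
    D.normEnd_coface (Nat.le_of_lt_succ (Finset.mem_range.1 hi)) φ

lemma smul_hochschild_normEnd (φ : D.Tup n → k) :
    (n + 2) • D.hochschild n (D.normEnd n φ) =
      (n + 2) • D.normEnd (n + 1) (D.hochschildTrunc n φ) := by
  have hlam := D.lamEnd_normEnd φ
  have h := D.hochschild_sub_lamEnd (D.normEnd n φ)
  rw [hlam, sub_self, map_zero, sub_eq_zero] at h
  rw [← show n + 1 + 1 = n + 2 from rfl, ← normEnd_eq_smul D h.symm, hochschild,
    LinearMap.sum_apply, map_sum, normEnd_hochschildTrunc, ← Finset.card_range (n + 1 + 1),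
    ← Finset.sum_const]
  refine Finset.sum_congr (by rw [Finset.card_range]) fun i hi => ?_
  rcases (Nat.le_of_lt_succ (Finset.mem_range.1 hi)).lt_or_eq with hi | rfl
  · rw [normEnd_coface D (Nat.le_of_lt_succ hi), lamEnd_pow_eq_self D hlam]
  · rw [← lamEnd_coface_zero, normEnd_lamEnd]

/-! ### Preservation of cochains -/

variable {D} in
lemma IsCochain.lamEnd {φ : D.Tup n → k} (hφ : D.IsCochain φ) : D.IsCochain (D.lamEnd n φ) :=
  (D.cochains n).smul_mem _ hφ.comp_rotT

variable {D} in
lemma IsCochain.lamEnd_pow {φ : D.Tup n → k} (hφ : D.IsCochain φ) (i : ℕ) :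
    D.IsCochain ((D.lamEnd n ^ i) φ) := by
  induction i with
  | zero => exact hφ
  | succ i ih =>
    rw [pow_succ', Module.End.mul_apply]
    exact ih.lamEnd

variable {D} in
lemma IsCochain.normEnd {φ : D.Tup n → k} (hφ : D.IsCochain φ) :
    D.IsCochain (D.normEnd n φ) := by
  rw [LinCat.normEnd, LinearMap.sum_apply]
  exact (D.cochains n).sum_mem fun i _ => hφ.lamEnd_pow i

variable {D} in
lemma IsCochain.coface {φ : D.Tup n → k} (hφ : D.IsCochain φ) {i : ℕ} (hi : i ≤ n + 1) :
    D.IsCochain (D.coface i φ) :=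
  (D.cochains (n + 1)).smul_mem _ (hφ.comp_face hi)

variable {D} in
lemma IsCochain.hochschild {φ : D.Tup n → k} (hφ : D.IsCochain φ) :
    D.IsCochain (D.hochschild n φ) := by
  rw [LinCat.hochschild, LinearMap.sum_apply]
  exact (D.cochains (n + 1)).sum_mem fun i hi =>
    hφ.coface (Nat.le_of_lt_succ (Finset.mem_range.1 hi))

variable {D} in
lemma IsCochain.hochschildTrunc {φ : D.Tup n → k} (hφ : D.IsCochain φ) :
    D.IsCochain (D.hochschildTrunc n φ) := by
  rw [LinCat.hochschildTrunc, LinearMap.sum_apply]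
  exact (D.cochains (n + 1)).sum_mem fun i hi =>
    hφ.coface (Finset.mem_range.1 hi).le

variable {D} in
lemma IsCochain.B0Op {φ : D.Tup (n + 1) → k} (hφ : D.IsCochain φ) : D.IsCochain (D.B0Op φ) := by
  have h : D.B0Op φ = (fun F => φ (D.rotT (D.snocIdT F))) -
      (-1 : k) ^ (n + 1) • fun F => φ (D.snocIdT F) := by
    funext F
    rw [Pi.sub_apply, Pi.smul_apply, rotT_snocIdT]
    rfl
  rw [h]
  exact (D.cochains n).sub_mem hφ.comp_rotT.comp_snocIdT
    ((D.cochains n).smul_mem _ hφ.comp_snocIdT)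

variable {D} in
lemma IsCochain.sub_lamEnd_eq {ψ : D.Tup (n + 1) → k} (hψ : D.IsCochain ψ)
    (h : D.lamEnd (n + 2) (D.hochschild (n + 1) ψ) = D.hochschild (n + 1) ψ) :
    ψ - D.lamEnd (n + 1) ψ = D.hochschildTrunc n (D.B0Op ψ) := by
  refine IsCochain.ext D ((D.cochains (n + 1)).sub_mem hψ hψ.lamEnd) hψ.B0Op.hochschildTrunc
    fun F hF => ?_
  have h0 := D.hochschild_sub_lamEnd ψ
  rw [h, sub_self] at h0
  have h1 := congrFun h0 (D.snocIdT F)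
  have hB : ∀ G : D.Tup n, (ψ - D.lamEnd (n + 1) ψ) (D.snocIdT G) = (-1) ^ n * D.B0Op ψ G := by
    intro G
    have hs : (-1 : k) ^ n * (-1) ^ n = 1 := by rw [← mul_pow]; simp
    rw [Pi.sub_apply, lamEnd_apply_apply, rotT_snocIdT, LinCat.B0Op, pow_succ]
    linear_combination (-(ψ (D.snocIdT G))) * hs
  rw [LinCat.hochschildTrunc, Finset.sum_range_succ, LinearMap.add_apply, LinearMap.sum_apply,
    Pi.add_apply, Finset.sum_apply, coface_apply, face_snocIdT_self D hF] at h1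
  have h2 : ∑ i ∈ Finset.range (n + 1), D.coface i (ψ - D.lamEnd (n + 1) ψ) (D.snocIdT F) =
      (-1) ^ n * D.hochschildTrunc n (D.B0Op ψ) F := by
    rw [LinCat.hochschildTrunc, LinearMap.sum_apply, Finset.sum_apply, Finset.mul_sum]
    refine Finset.sum_congr rfl fun i hi => ?_
    rw [coface_apply, coface_apply, face_snocIdT D (Nat.le_of_lt_succ (Finset.mem_range.1 hi)),
      hB]
    ring
  rw [h2, Pi.zero_apply, pow_succ] at h1
  have hs : (-1 : k) ^ n * (-1) ^ n = 1 := by rw [← mul_pow]; simp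
  linear_combination (-1 : k) ^ n * h1 +
    (D.hochschildTrunc n (D.B0Op ψ) F - (ψ - D.lamEnd (n + 1) ψ) F) * hs

end LinCat

lemma Finset.sum_range_succ_sum_range {α : Type*} [AddCommMonoid α] (N : ℕ) (G : ℕ → ℕ → α) :
    ∑ j ∈ Finset.range (N + 1), ∑ i ∈ Finset.range N, G i j =
      ∑ j ∈ Finset.range (N + 1), ∑ i ∈ Finset.range j, (G i j + G (j - 1) i) := by
  induction N with
  | zero => simp
  | succ N ih =>
    rw [Finset.sum_range_succ, Finset.sum_range_succ _ (N + 1), ← ih]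
    simp only [Finset.sum_range_succ _ N, Finset.sum_add_distrib, Nat.add_sub_cancel]
    abel

lemma Finset.sum_range_succ_sum_range_eq_zero {k : Type*} [CommRing k] (N : ℕ) (Y : ℕ → ℕ → k)
    (hY : ∀ i j, i < j → j ≤ N → Y (j - 1) i = -Y i j) :
    ∑ j ∈ Finset.range (N + 1), ∑ i ∈ Finset.range N, Y i j = 0 := by
  rw [Finset.sum_range_succ_sum_range]
  refine Finset.sum_eq_zero fun j hj => Finset.sum_eq_zero fun i hi => ?_
  rw [hY i j (Finset.mem_range.1 hi) (Nat.le_of_lt_succ (Finset.mem_range.1 hj)), add_neg_cancel]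

lemma Finset.sum_range_succ_sum_range_weighted {k : Type*} [CommRing k] (N : ℕ) (Y : ℕ → ℕ → k)
    (hY : ∀ i j, i < j → j ≤ N → Y (j - 1) i = -Y i j)
    (h0 : ∀ j ≤ N, ∑ i ∈ Finset.range N, Y i j = 0) :
    ∑ j ∈ Finset.range (N + 1), ∑ i ∈ Finset.range N, ((N : k) - 1 - i) * Y i j =
      -∑ j ∈ Finset.range N, ∑ i ∈ Finset.range j, Y i j := by
  let w : ℕ → k := fun j => if j < N then j else (N : k) - 1
  have h1 : ∑ j ∈ Finset.range (N + 1), ∑ i ∈ Finset.range N, ((N : k) - 1 - i) * Y i j =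
      ∑ j ∈ Finset.range (N + 1), ∑ i ∈ Finset.range N, ((N : k) - 1 - i - w j) * Y i j := by
    refine Finset.sum_congr rfl fun j hj => ?_
    simp only [sub_mul _ (w j), Finset.sum_sub_distrib, ← Finset.mul_sum]
    rw [h0 j (Nat.le_of_lt_succ (Finset.mem_range.1 hj)), mul_zero, sub_zero]
  rw [h1, Finset.sum_range_succ_sum_range, Finset.sum_range_succ, ← Finset.sum_neg_distrib]
  have key : ∀ i j, i < j → j ≤ N → ((N : k) - 1 - i - w j) * Y i j +
      ((N : k) - 1 - (j - 1 : ℕ) - w i) * Y (j - 1) i = (j - 1 - i - w j + w i) * Y i j := by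
    intro i j hij hj
    rw [hY i j hij hj, Nat.cast_sub (by omega), Nat.cast_one]
    ring
  have hlast : ∑ i ∈ Finset.range N, (((N : k) - 1 - i - w N) * Y i N +
      ((N : k) - 1 - (N - 1 : ℕ) - w i) * Y (N - 1) i) = 0 := by
    refine Finset.sum_eq_zero fun i hi => ?_
    have hi := Finset.mem_range.1 hi
    rw [key i N hi le_rfl]
    simp only [w, if_neg (lt_irrefl N), if_pos hi]
    ring
  rw [hlast, add_zero]
  refine Finset.sum_congr rfl fun j hj => ?_
  rw [← Finset.sum_neg_distrib]
  refine Finset.sum_congr rfl fun i hi => ?_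
  have hj := Finset.mem_range.1 hj
  have hi := Finset.mem_range.1 hi
  rw [key i j hi hj.le]
  simp only [w, if_pos hj, if_pos (hi.trans hj)]
  ring

namespace LinCat

variable {k : Type} [CommRing k] (D : LinCat k) {n : ℕ}

lemma signed_face_face (φ : D.Tup n → k) (F : D.Tup (n + 2)) {i j : ℕ} (hij : i < j)
    (hj : j ≤ n + 2) :
    (-1) ^ (j - 1 + i) * φ (D.face (j - 1) (D.face i F)) =
      -((-1) ^ (i + j) * φ (D.face i (D.face j F))) := by
  obtain ⟨j, rfl⟩ : ∃ j', j = j' + 1 := ⟨j - 1, by omega⟩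
  rw [← face_face D hij hj, Nat.add_sub_cancel]
  ring

lemma hochschild_apply_apply (φ : D.Tup n → k) (F : D.Tup (n + 1)) :
    D.hochschild n φ F = ∑ i ∈ Finset.range (n + 2), (-1) ^ i * φ (D.face i F) := by
  rw [hochschild, LinearMap.sum_apply, Finset.sum_apply]
  rfl

lemma hochschild_hochschild (φ : D.Tup n → k) :
    D.hochschild (n + 1) (D.hochschild n φ) = 0 := by
  funext F
  simp only [hochschild_apply_apply, Finset.mul_sum, ← mul_assoc, ← pow_add, Pi.zero_apply]
  rw [← Finset.sum_range_succ_sum_range_eq_zero (n + 2)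
    (fun i j => (-1) ^ (i + j) * φ (D.face i (D.face j F))) fun i j => D.signed_face_face φ F]
  exact Finset.sum_congr rfl fun j _ => Finset.sum_congr rfl fun i _ => by rw [add_comm]

end LinCat
namespace LinCat

variable {k : Type} [CommRing k] (D : LinCat k) {n : ℕ}

/-- The operator `∑ (n + 1 - i) (-1)^i δ_i` in which the cofaces are weighted by their position. -/
noncomputable def weightedCoface (n : ℕ) : (D.Tup n → k) →ₗ[k] (D.Tup (n + 1) → k) :=
  ∑ i ∈ Finset.range (n + 2), ((n : k) + 1 - i) • D.coface i

lemma hochschild_weightedCoface {φ : D.Tup n → k} (hφ : D.hochschild n φ = 0)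
    (F : D.Tup (n + 2)) :
    D.hochschild (n + 1) (D.weightedCoface n φ) F =
      -∑ j ∈ Finset.range (n + 2), ∑ i ∈ Finset.range j,
        (-1) ^ (i + j) * φ (D.face i (D.face j F)) := by
  rw [← Finset.sum_range_succ_sum_range_weighted (n + 2)
    (fun i j => (-1) ^ (i + j) * φ (D.face i (D.face j F))) fun i j => D.signed_face_face φ F]
  · rw [hochschild_apply_apply]
    refine Finset.sum_congr rfl fun j _ => ?_
    rw [weightedCoface, LinearMap.sum_apply, Finset.sum_apply, Finset.mul_sum]
    refine Finset.sum_congr rfl fun i _ => ?_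
    rw [LinearMap.smul_apply, Pi.smul_apply, coface_apply, smul_eq_mul]
    push_cast
    ring
  · intro j _
    have h := congrFun hφ (D.face j F)
    rw [hochschild_apply_apply, Pi.zero_apply] at h
    simp only [pow_add, mul_right_comm _ ((-1 : k) ^ j)]
    rw [← Finset.sum_mul, h, zero_mul]

lemma weightedCoface_sub_lamEnd {φ : D.Tup n → k} (hlam : D.lamEnd n φ = φ)
    (hφ : D.hochschild n φ = 0) :
    D.weightedCoface n φ - D.lamEnd (n + 1) (D.weightedCoface n φ) =
      ((n : k) + 2) • D.hochschildTrunc n φ := by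
  have h1 : D.lamEnd (n + 1) (D.weightedCoface n φ) =
      ∑ i ∈ Finset.range (n + 1), ((n : k) - i) • D.coface i φ +
        ((n : k) + 1) • D.coface (n + 1) φ := by
    rw [weightedCoface, LinearMap.sum_apply, map_sum, Finset.sum_range_succ']
    simp only [LinearMap.smul_apply, map_smul]
    rw [lamEnd_coface_zero, Nat.cast_zero, sub_zero]
    congr 1
    refine Finset.sum_congr rfl fun i hi => ?_
    rw [lamEnd_coface_succ D (Nat.le_of_lt_succ (Finset.mem_range.1 hi)), hlam]
    push_cast
    congr 1
    ring
  have h2 : D.weightedCoface n φ =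
      ∑ i ∈ Finset.range (n + 1), ((n : k) + 1 - i) • D.coface i φ := by
    rw [weightedCoface, LinearMap.sum_apply, Finset.sum_range_succ]
    simp
  have h3 : D.weightedCoface n φ - D.lamEnd (n + 1) (D.weightedCoface n φ) =
      D.hochschildTrunc n φ - ((n : k) + 1) • D.coface (n + 1) φ := by
    rw [h1, h2, ← sub_sub, ← Finset.sum_sub_distrib, hochschildTrunc, LinearMap.sum_apply]
    congr 1
    refine Finset.sum_congr rfl fun i _ => ?_
    rw [← sub_smul]
    ring_nf
    rw [one_smul]
  rw [hochschild_eq_trunc_add, add_eq_zero_iff_neg_eq'] at hφ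
  rw [h3, ← neg_eq_iff_eq_neg.2 hφ.symm]
  module

variable {D} in
lemma IsCochain.weightedCoface {φ : D.Tup n → k} (hφ : D.IsCochain φ) :
    D.IsCochain (D.weightedCoface n φ) := by
  rw [LinCat.weightedCoface, LinearMap.sum_apply]
  exact (D.cochains (n + 1)).sum_mem fun i hi =>
    (D.cochains (n + 1)).smul_mem _ (hφ.coface (Nat.le_of_lt_succ (Finset.mem_range.1 hi)))

variable {D} in
lemma IsCochain.exists_sub_normEnd_eq {β : D.Tup n → k} (hβ : D.IsCochain β) :
    ∃ ω, D.IsCochain ω ∧ ((n : k) + 1) • β - D.normEnd n β = ω - D.lamEnd n ω := by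
  refine ⟨∑ i ∈ Finset.range (n + 1), ∑ j ∈ Finset.range i, (D.lamEnd n ^ j) β,
    (D.cochains n).sum_mem fun i _ => (D.cochains n).sum_mem fun j _ => hβ.lamEnd_pow j, ?_⟩
  rw [map_sum, ← Finset.sum_sub_distrib]
  have h : ∀ i, ∑ j ∈ Finset.range i, (D.lamEnd n ^ j) β -
      D.lamEnd n (∑ j ∈ Finset.range i, (D.lamEnd n ^ j) β) = β - (D.lamEnd n ^ i) β := by
    intro i
    have := LinearMap.congr_fun (mul_neg_geom_sum (D.lamEnd n) i) β
    rw [Module.End.mul_apply, LinearMap.sum_apply] at this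
    exact this
  rw [Finset.sum_congr rfl fun i _ => h i, Finset.sum_sub_distrib, Finset.sum_const,
    Finset.card_range, LinCat.normEnd, LinearMap.sum_apply, ← Nat.cast_smul_eq_nsmul k]
  push_cast
  rfl

variable {D} in
lemma IsCochain.hochschild_BOp [IsAddTorsionFree k] {ψ : D.Tup (n + 1) → k} (hψ : D.IsCochain ψ)
    (h : D.lamEnd (n + 2) (D.hochschild (n + 1) ψ) = D.hochschild (n + 1) ψ) :
    D.hochschild n (D.BOp ψ) = 0 := by
  have h1 := D.smul_hochschild_normEnd (D.B0Op ψ)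
  rw [← hψ.sub_lamEnd_eq h, map_sub, normEnd_lamEnd, sub_self, smul_zero, normEnd_apply] at h1
  exact (nsmul_eq_zero_iff_right (by omega)).1 h1

variable {D} in
/-- The correction term relating `S (B ψ)` and `(n + 1) (n + 2) b ψ`. -/
lemma IsCochain.exists_cyclic_weightedCoface_sub [IsAddTorsionFree k] {ψ : D.Tup (n + 1) → k}
    (hψ : D.IsCochain ψ)
    (h : D.lamEnd (n + 2) (D.hochschild (n + 1) ψ) = D.hochschild (n + 1) ψ) :
    ∃ χ, D.IsCochain χ ∧ D.lamEnd (n + 1) χ = χ ∧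
      D.hochschild (n + 1) χ = D.hochschild (n + 1) (D.weightedCoface n (D.BOp ψ)) -
        (((n : k) + 1) * ((n : k) + 2)) • D.hochschild (n + 1) ψ := by
  obtain ⟨ω, hω, hωβ⟩ := hψ.B0Op.exists_sub_normEnd_eq
  have hφ : D.IsCochain (D.BOp ψ) := by
    rw [BOp, ← normEnd_apply]
    exact hψ.B0Op.normEnd
  have hlam : D.lamEnd n (D.BOp ψ) = D.BOp ψ := by
    rw [BOp, ← normEnd_apply, lamEnd_normEnd]
  have hθ := D.weightedCoface_sub_lamEnd hlam (hψ.hochschild_BOp h)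
  have hψ' := hψ.sub_lamEnd_eq h
  have hbω := D.hochschild_sub_lamEnd ω
  rw [← hωβ, _root_.map_sub, _root_.map_smul, normEnd_apply] at hbω
  refine ⟨D.weightedCoface n (D.BOp ψ) - (((n : k) + 1) * ((n : k) + 2)) • ψ +
    ((n : k) + 2) • D.hochschild n ω, ?_, ?_, ?_⟩
  · exact (D.cochains _).add_mem ((D.cochains _).sub_mem hφ.weightedCoface
      ((D.cochains _).smul_mem _ hψ)) ((D.cochains _).smul_mem _ hω.hochschild)
  · rw [_root_.map_add, map_sub, _root_.map_smul, _root_.map_smul]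
    rw [BOp] at *
    rw [eq_sub_of_add_eq' (sub_eq_iff_eq_add.1 hθ).symm,
      eq_sub_of_add_eq' (sub_eq_iff_eq_add.1 hψ').symm,
      eq_sub_of_add_eq' (sub_eq_iff_eq_add.1 hbω).symm]
    module
  · rw [_root_.map_add, map_sub, _root_.map_smul, _root_.map_smul, hochschild_hochschild, smul_zero, add_zero]

end LinCat
namespace DGStr

variable {k : Type} [CommRing k] {Obj : Type} (S : DGStr k Obj)

lemma comp_zero {X Y Z : Obj} {i j : ℕ} (g : S.Hom Y Z i) :
    S.comp g (0 : S.Hom X Y j) = 0 := by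
  simpa using S.comp_smul_right (0 : k) g (0 : S.Hom X Y j)

lemma zero_comp {X Y Z : Obj} {i j : ℕ} (f : S.Hom X Y j) :
    S.comp (0 : S.Hom Y Z i) f = 0 := by
  simpa using S.comp_smul_left (0 : k) (0 : S.Hom Y Z i) f

lemma mk_cst {A B : Obj} {i j : ℕ} (h : i = j) (f : S.Hom A B i) :
    (⟨A, B, j, S.cst h f⟩ : S.M) = ⟨A, B, i, f⟩ := by
  subst h
  rw [cst_rfl]

lemma mk_zero_congr {A A' B B' : Obj} {i j : ℕ} (hA : A = A') (hB : B = B') (h : i = j) :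
    (⟨A, B, i, 0⟩ : S.M) = ⟨A', B', j, 0⟩ := by
  subst hA hB h; rfl

lemma sc_mk {A B E : Obj} {i j : ℕ} (g : S.Hom B E i) (f : S.Hom A B j) :
    S.sc ⟨B, E, i, g⟩ ⟨A, B, j, f⟩ = ⟨A, E, i + j, S.comp g f⟩ := by
  simp [sc]

lemma sc_of_ne {x y : S.M} (h : y.2.1 ≠ x.1) :
    S.sc x y = ⟨y.1, x.2.1, x.2.2.1 + y.2.2.1, 0⟩ := by
  simp [sc, h]

@[simp] lemma sc_fst (x y : S.M) : (S.sc x y).1 = y.1 := by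
  by_cases h : y.2.1 = x.1
  · rw [sc, dif_pos h]
  · rw [sc, dif_neg h]

@[simp] lemma sc_snd_fst (x y : S.M) : (S.sc x y).2.1 = x.2.1 := by
  by_cases h : y.2.1 = x.1
  · rw [sc, dif_pos h]
  · rw [sc, dif_neg h]

@[simp] lemma sc_degree (x y : S.M) : (S.sc x y).2.2.1 = x.2.2.1 + y.2.2.1 := by
  by_cases h : y.2.1 = x.1
  · rw [sc, dif_pos h]
  · rw [sc, dif_neg h]

lemma sc_zero (x : S.M) (A B : Obj) (i : ℕ) :
    S.sc x ⟨A, B, i, 0⟩ = ⟨A, x.2.1, x.2.2.1 + i, 0⟩ := by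
  by_cases h : B = x.1
  · obtain ⟨X, Y, j, f⟩ := x
    subst h
    rw [sc_mk, comp_zero]
  · exact S.sc_of_ne h

lemma zero_sc (x : S.M) (A B : Obj) (i : ℕ) :
    S.sc ⟨A, B, i, 0⟩ x = ⟨x.1, B, i + x.2.2.1, 0⟩ := by
  by_cases h : x.2.1 = A
  · obtain ⟨X, Y, j, f⟩ := x
    subst h
    rw [sc_mk, zero_comp]
  · exact S.sc_of_ne h

lemma sc_assoc (x y z : S.M) : S.sc (S.sc x y) z = S.sc x (S.sc y z) := by
  by_cases hxy : y.2.1 = x.1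
  · by_cases hyz : z.2.1 = y.1
    · obtain ⟨X, X', i, f⟩ := x
      obtain ⟨Y, Y', j, g⟩ := y
      obtain ⟨Z, Z', l, h⟩ := z
      dsimp only at hxy hyz
      subst hxy hyz
      simp only [sc_mk, S.comp_assoc, mk_cst]
    · rw [S.sc_of_ne hyz, sc_zero, S.sc_of_ne (by simpa using hyz)]
      exact S.mk_zero_congr rfl (by simp) (by simp [add_assoc])
  · rw [S.sc_of_ne hxy, zero_sc, S.sc_of_ne (by simpa using hxy)]
    exact S.mk_zero_congr (by simp) rfl (by simp [add_assoc])

/-- `z = x + y`, for bundled morphisms with the same endpoints and degree. -/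
def IsSum (x y z : S.M) : Prop :=
  ∃ (A B : Obj) (i : ℕ) (f g : S.Hom A B i),
    x = ⟨A, B, i, f⟩ ∧ y = ⟨A, B, i, g⟩ ∧ z = ⟨A, B, i, f + g⟩

variable {S}

lemma IsSum.sc_left {x y z : S.M} (h : S.IsSum x y z) (w : S.M) :
    S.IsSum (S.sc w x) (S.sc w y) (S.sc w z) := by
  obtain ⟨A, B, i, f, g, rfl, rfl, rfl⟩ := h
  by_cases hw : B = w.1
  · obtain ⟨X, Y, j, u⟩ := w
    subst hw
    exact ⟨A, Y, j + i, S.comp u f, S.comp u g, S.sc_mk _ _, S.sc_mk _ _, by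
      rw [sc_mk, S.comp_add_right]⟩
  · exact ⟨A, w.2.1, w.2.2.1 + i, 0, 0, S.sc_of_ne hw, S.sc_of_ne hw, by
      rw [S.sc_of_ne hw, add_zero]⟩

lemma IsSum.sc_right {x y z : S.M} (h : S.IsSum x y z) (w : S.M) :
    S.IsSum (S.sc x w) (S.sc y w) (S.sc z w) := by
  obtain ⟨A, B, i, f, g, rfl, rfl, rfl⟩ := h
  by_cases hw : w.2.1 = A
  · obtain ⟨X, Y, j, u⟩ := w
    subst hw
    exact ⟨X, B, i + j, S.comp f u, S.comp g u, S.sc_mk _ _, S.sc_mk _ _, by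
      rw [sc_mk, S.comp_add_left]⟩
  · exact ⟨w.1, B, i + w.2.2.1, 0, 0, S.sc_of_ne hw, S.sc_of_ne hw, by
      rw [S.sc_of_ne hw, add_zero]⟩

variable (S) in
lemma isSum_dM_sc {A B E : Obj} (g : S.Hom B E 0) (f : S.Hom A B 0) :
    S.IsSum (S.sc (S.dM ⟨B, E, 0, g⟩) ⟨A, B, 0, f⟩) (S.sc ⟨B, E, 0, g⟩ (S.dM ⟨A, B, 0, f⟩))
      (S.dM (S.sc ⟨B, E, 0, g⟩ ⟨A, B, 0, f⟩)) := by
  refine ⟨A, E, 0 + 0 + 1, S.cst (by omega) (S.comp (S.d g) f), S.comp g (S.d f), ?_, ?_, ?_⟩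
  · rw [mk_cst]
    exact S.sc_mk _ _
  · exact S.sc_mk _ _
  · rw [sc_mk, dM, S.leibniz, pow_zero, one_smul]

lemma IsSum.ev_eq {n : ℕ} (Tr : GrTrace S n) {x y z : S.M} (h : S.IsSum x y z) :
    Tr.ev z = Tr.ev x + Tr.ev y := by
  obtain ⟨A, B, i, f, g, rfl, rfl, rfl⟩ := h
  by_cases hc : A = B ∧ i = n
  · obtain ⟨rfl, rfl⟩ := hc
    simp [GrTrace.ev, Tr.T_add]
  · simp [GrTrace.ev, hc]

lemma prodM_map_range_succ (x : S.M) (g : ℕ → S.M) (N : ℕ) :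
    S.prodM x ((List.range (N + 1)).map g) = S.sc (S.prodM x ((List.range N).map g)) (g N) := by
  simp [prodM, List.range_succ]

variable (S) in
/-- The product `s 0 ⋅ ∂(s 1) ⋯ s j ⋯ ∂(s N)` in which the `j`-th factor is not
differentiated. -/
noncomputable def prodSkip (s : ℕ → S.M) (j N : ℕ) : S.M :=
  S.prodM (s 0) ((List.range N).map fun l => if l + 1 = j then s (l + 1) else S.dM (s (l + 1)))

lemma prodSkip_succ (s : ℕ → S.M) (j N : ℕ) :
    S.prodSkip s j (N + 1) =
      S.sc (S.prodSkip s j N) (if N + 1 = j then s (N + 1) else S.dM (s (N + 1))) :=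
  prodM_map_range_succ _ _ _

lemma prodSkip_one (s : ℕ → S.M) (N : ℕ) :
    S.prodSkip s 1 (N + 1) =
      S.prodM (S.sc (s 0) (s 1)) ((List.range N).map fun l => S.dM (s (l + 2))) := by
  simp [prodSkip, prodM, List.range_succ_eq_map, Function.comp_def]

lemma isSum_prodSkip (s : ℕ → S.M) {j N : ℕ} (hN : j < N)
    (hs : S.IsSum (S.sc (S.dM (s (j + 1))) (s (j + 2))) (S.sc (s (j + 1)) (S.dM (s (j + 2))))
      (S.dM (S.sc (s (j + 1)) (s (j + 2))))) :
    S.IsSum (S.prodSkip s (j + 2) (N + 1)) (S.prodSkip s (j + 1) (N + 1))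
      (S.prodM (s 0) ((List.range N).map fun l =>
        if l < j then S.dM (s (l + 1))
        else if l = j then S.dM (S.sc (s (j + 1)) (s (j + 2)))
        else S.dM (s (l + 2)))) := by
  induction N, hN using Nat.le_induction with
  | base =>
    have h : ∀ i, j ≤ i → (List.range j).map (fun l => if l + 1 = i + 1 then s (l + 1)
        else S.dM (s (l + 1))) = (List.range j).map fun l => S.dM (s (l + 1)) := fun i hi =>
      List.map_congr_left fun l hl => if_neg (by have := List.mem_range.1 hl; omega)
    have h' : (List.range j).map (fun l => if l < j then S.dM (s (l + 1))
        else if l = j then S.dM (S.sc (s (j + 1)) (s (j + 2))) else S.dM (s (l + 2))) =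
        (List.range j).map fun l => S.dM (s (l + 1)) :=
      List.map_congr_left fun l hl => if_pos (List.mem_range.1 hl)
    simp only [prodSkip, Nat.succ_eq_add_one, prodM_map_range_succ, h j le_rfl,
      h (j + 1) (Nat.le_succ j), h', sc_assoc]
    simpa using hs.sc_left _
  | succ N hN ih =>
    have h1 : N + 1 + 1 ≠ j + 2 := by omega
    have h2 : N + 1 + 1 ≠ j + 1 := by omega
    have h3 : ¬ N < j := by omega
    have h4 : N ≠ j := by omega
    rw [prodM_map_range_succ, prodSkip_succ _ _ (N + 1), prodSkip_succ _ _ (N + 1), if_neg h1,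
      if_neg h2, if_neg h3, if_neg h4]
    exact ih.sc_right _

end DGStr

lemma List.filterMap_range_eq_map {α : Type*} {o : ℕ → Option α} {c : ℕ → α} {j N : ℕ}
    (hj : j ≤ N) (h1 : ∀ l < j, o l = some (c l)) (h2 : o j = none)
    (h3 : ∀ l < N, j ≤ l → o (l + 1) = some (c l)) :
    (List.range (N + 1)).filterMap o = (List.range N).map c := by
  induction N, hj using Nat.le_induction with
  | base =>
    rw [List.range_succ, List.filterMap_append, List.filterMap_cons, h2, List.filterMap_nil,
      List.append_nil, ← List.filterMap_eq_map]
    exact List.filterMap_congr fun l hl => h1 l (List.mem_range.1 hl)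
  | succ N hN ih =>
    rw [List.range_succ, List.filterMap_append, ih fun l hl => h3 l (by omega),
      List.range_succ, List.map_append]
    simp [h3 N (by omega) hN]

lemma List.filterMap_finRange_eq {α : Type*} {N : ℕ} {f : Fin N → Option α} {o : ℕ → Option α}
    (h : ∀ l : Fin N, f l = o l) : (List.finRange N).filterMap f = (List.range N).filterMap o := by
  have : f = o ∘ Fin.val := funext h
  rw [this, ← List.filterMap_map, List.map_coe_finRange_eq_range]

namespace LinCat

variable {k : Type} [CommRing k] (D : LinCat k) {n : ℕ} {Obj' : Type} {S : DGStr k Obj'}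

/-- The images of the entries of a tuple under a semifunctor, indexed by `ℕ`. -/
def sigSeq (ρ : SemiFun0 D.toSemiCat S) (F : D.Tup n) (l : ℕ) : S.M :=
  ρ.sig (F (Fin.ofNat (n + 1) l))

variable (ρ : SemiFun0 D.toSemiCat S)

lemma sigSeq_of_lt (F : D.Tup n) {l : ℕ} (h : l < n + 1) :
    D.sigSeq ρ F l = ρ.sig (F ⟨l, h⟩) := by
  rw [sigSeq]
  congr 2
  exact Fin.ext (Nat.mod_eq_of_lt h)

lemma sigSeq_faceT_of_lt (F : D.Tup (n + 1)) {i j : ℕ} (hj : j < n + 1) (h : j < i) :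
    D.sigSeq ρ (D.faceT i F) j = D.sigSeq ρ F j := by
  rw [sigSeq_of_lt D ρ _ hj, sigSeq_of_lt D ρ _ (by omega), faceT_of_lt D F hj h]

lemma sigSeq_faceT_of_gt (F : D.Tup (n + 1)) {i j : ℕ} (hj : j < n + 1) (h : i < j) :
    D.sigSeq ρ (D.faceT i F) j = D.sigSeq ρ F (j + 1) := by
  rw [sigSeq_of_lt D ρ _ hj, sigSeq_of_lt D ρ _ (by omega), faceT_of_gt D F hj h]

lemma sigSeq_faceT_self {F : D.Tup (n + 1)} (hF : D.IsCyc F) {i : ℕ} (hi : i < n + 1) :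
    D.sigSeq ρ (D.faceT i F) i = S.sc (D.sigSeq ρ F i) (D.sigSeq ρ F (i + 1)) := by
  rw [sigSeq_of_lt D ρ _ hi, sigSeq_of_lt D ρ F (by omega : i < n + 1 + 1),
    sigSeq_of_lt D ρ F (by omega : i + 1 < n + 1 + 1), faceT_self D F hi]
  have h := ((D.isCyc_iff F).1 hF).2 i hi
  generalize F ⟨i, _⟩ = x at h ⊢
  generalize F ⟨i + 1, _⟩ = y at h ⊢
  obtain ⟨X, X', f⟩ := x
  obtain ⟨Y, Y', g⟩ := y
  dsimp only at h
  subst h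
  rw [SemiCat.sc_mk]
  simp only [SemiFun0.sig, DGStr.sc_mk, ρ.map_comp]

lemma isSum_sigSeq {F : D.Tup n} (hF : D.IsCyc F) {i : ℕ} (hi : i < n) :
    S.IsSum (S.sc (S.dM (D.sigSeq ρ F i)) (D.sigSeq ρ F (i + 1)))
      (S.sc (D.sigSeq ρ F i) (S.dM (D.sigSeq ρ F (i + 1))))
      (S.dM (S.sc (D.sigSeq ρ F i) (D.sigSeq ρ F (i + 1)))) := by
  rw [sigSeq_of_lt D ρ F (by omega : i < n + 1), sigSeq_of_lt D ρ F (by omega : i + 1 < n + 1)]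
  have h := ((D.isCyc_iff F).1 hF).2 i hi
  generalize F ⟨i, _⟩ = x at h ⊢
  generalize F ⟨i + 1, _⟩ = y at h ⊢
  obtain ⟨X, X', f⟩ := x
  obtain ⟨Y, Y', g⟩ := y
  dsimp only at h
  subst h
  exact S.isSum_dM_sc _ _

lemma cycleChar_eq (Tr : GrTrace S n) (F : D.Tup n) :
    cycleChar D Tr ρ F = Tr.ev (S.prodM (D.sigSeq ρ F 0)
      ((List.range n).map fun l => S.dM (D.sigSeq ρ F (l + 1)))) := by
  rw [cycleChar, ← List.map_coe_finRange_eq_range, List.map_map]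
  refine congrArg Tr.ev (congrArg (S.prodM _) (List.map_congr_left fun l _ => ?_))
  exact congrArg S.dM (D.sigSeq_of_lt ρ F (by omega)).symm

lemma cycleChar_face_zero (Tr : GrTrace S n) {F : D.Tup (n + 1)} (hF : D.IsCyc F) :
    cycleChar D Tr ρ (D.face 0 F) = Tr.ev (S.prodSkip (D.sigSeq ρ F) 1 (n + 1)) := by
  rw [cycleChar_eq, DGStr.prodSkip_one, face_of_le D (Nat.zero_le n),
    sigSeq_faceT_self D ρ hF (Nat.succ_pos n)]
  refine congrArg Tr.ev (congrArg (S.prodM _) (List.map_congr_left fun l hl => ?_))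
  have hl := List.mem_range.1 hl
  rw [sigSeq_faceT_of_gt D ρ F (by omega) (by omega)]

lemma cycleChar_face_succ (Tr : GrTrace S n) {F : D.Tup (n + 1)} (hF : D.IsCyc F) {i : ℕ}
    (hi : i < n) :
    cycleChar D Tr ρ (D.face (i + 1) F) = Tr.ev (S.prodSkip (D.sigSeq ρ F) (i + 2) (n + 1)) +
      Tr.ev (S.prodSkip (D.sigSeq ρ F) (i + 1) (n + 1)) := by
  rw [cycleChar_eq, ← (DGStr.isSum_prodSkip (D.sigSeq ρ F) hi
    (D.isSum_sigSeq ρ hF (by omega))).ev_eq Tr, face_of_le D (by omega : i + 1 ≤ n),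
    sigSeq_faceT_of_lt D ρ F (by omega) (by omega)]
  refine congrArg Tr.ev (congrArg (S.prodM _) (List.map_congr_left fun l hl => ?_))
  have hl := List.mem_range.1 hl
  rcases lt_trichotomy l i with h | rfl | h
  · rw [if_pos h, sigSeq_faceT_of_lt D ρ F (by omega) (by omega)]
  · rw [if_neg (lt_irrefl l), if_pos rfl, sigSeq_faceT_self D ρ hF (by omega)]
  · rw [if_neg h.not_gt, if_neg h.ne', sigSeq_faceT_of_gt D ρ F (by omega) (by omega)]

lemma ev_prodSkip_eq_sum (Tr : GrTrace S n) {F : D.Tup (n + 1)} (hF : D.IsCyc F) {j : ℕ}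
    (hj : j ≤ n) :
    Tr.ev (S.prodSkip (D.sigSeq ρ F) (j + 1) (n + 1)) =
      ∑ i ∈ Finset.range (j + 1), (-1) ^ (j + i) * cycleChar D Tr ρ (D.face i F) := by
  induction j with
  | zero => simp [cycleChar_face_zero D ρ Tr hF]
  | succ j ih =>
    have h : ∀ i ∈ Finset.range (j + 1),
        (-1 : k) ^ (j + 1 + i) * cycleChar D Tr ρ (D.face i F) =
          -((-1) ^ (j + i) * cycleChar D Tr ρ (D.face i F)) := fun i _ => by ring
    rw [Finset.sum_range_succ, Finset.sum_congr rfl h, Finset.sum_neg_distrib, ← ih (by omega),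
      cycleChar_face_succ D ρ Tr hF hj, (Even.add_self (j + 1)).neg_one_pow]
    ring

lemma sCharTerm_eq (Tr : GrTrace S n) {F : D.Tup (n + 2)} (hF : D.IsCyc F) {j : ℕ}
    (hj : j ≤ n) :
    sCharTerm D Tr ρ (j + 1) F =
      Tr.ev (S.prodSkip (D.sigSeq ρ (D.face (j + 1) F)) (j + 1) (n + 1)) := by
  rw [face_of_le D (by omega), sCharTerm, DGStr.prodSkip,
    sigSeq_faceT_of_lt D ρ F (by omega) (by omega)]
  refine congrArg Tr.ev (congrArg (S.prodM _) ?_)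
  rw [List.filterMap_finRange_eq (o := fun l => if l + 1 = j + 1 + 1 then none
    else if l + 1 = j + 1 then
      some (S.sc (D.sigSeq ρ F (j + 1)) (D.sigSeq ρ F (j + 2)))
    else some (S.dM (D.sigSeq ρ F (l + 1))))]
  · refine List.filterMap_range_eq_map (j := j + 1) (by omega) (fun l hl => ?_) (by simp)
      fun l hl hjl => ?_
    · rw [if_neg (by omega)]
      split_ifs with h
      · rw [h, sigSeq_faceT_self D ρ hF (by omega)]
      · rw [sigSeq_faceT_of_lt D ρ F (by omega) (by omega)]
    · rw [if_neg (by omega), if_neg (by omega), if_neg (by omega),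
        sigSeq_faceT_of_gt D ρ F (by omega) (by omega)]
  · rintro ⟨l, hl⟩
    have h1 : min (j + 1) (n + 1) = j + 1 := by omega
    have h2 : min (j + 1 + 1) (n + 2) = j + 1 + 1 := by omega
    simp only [h1, h2]
    rw [sigSeq_of_lt D ρ F (by omega : j + 1 < n + 2 + 1),
      sigSeq_of_lt D ρ F (by omega : j + 2 < n + 2 + 1),
      sigSeq_of_lt D ρ F (by omega : l + 1 < n + 2 + 1)]

lemma sCharOp_eq (Tr : GrTrace S n) {φ : D.Tup n → k} (hφ : IsCharOf D S Tr ρ φ)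
    {F : D.Tup (n + 2)} (hF : D.IsCyc F) :
    sCharOp D Tr ρ F = -∑ j ∈ Finset.range (n + 2), ∑ i ∈ Finset.range j,
      (-1) ^ (i + j) * φ (D.face i (D.face j F)) := by
  rw [sCharOp, Finset.sum_range_succ', Finset.range_zero, Finset.sum_empty, add_zero,
    ← Finset.sum_neg_distrib, Finset.range_eq_Ico, ← Finset.Ico_add_one_right_eq_Icc,
    ← Finset.sum_Ico_add' _ 0 (n + 1) 1]
  refine Finset.sum_congr rfl fun j hj => ?_
  have hj := (Finset.mem_Ico.1 hj).2
  have hG := D.isCyc_face (by omega : j + 1 ≤ n + 1 + 1) hF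
  rw [sCharTerm_eq D ρ Tr hF (by omega), ev_prodSkip_eq_sum D ρ Tr hG (by omega),
    ← Finset.sum_neg_distrib]
  refine Finset.sum_congr rfl fun i hi => ?_
  rw [hφ _ (D.isCyc_face (by have := Finset.mem_range.1 hi; omega) hG)]
  ring

end LinCat

/-- **Statement 17.**  Let `C` be a small `ℂ`-linear category and let
`ψ ∈ CN^n(C)` (here `n = m + 1 ≥ 1`) be such that `bψ ∈ C^{n+1}_λ(C)`.
Then: (1) `Bψ` is a cyclic cocycle, i.e. `b(Bψ) = 0` and `(1-λ)(Bψ) = 0`;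
(2) `S(Bψ) = n(n+1)·bψ` in `H^{n+1}_λ(C)`: for every cycle
`(S, ∂, T̂, ρ)` over `C` of dimension `n - 1` whose character is `Bψ`,
the cochain `S(Bψ)` (given by Lemma `Sform` for this cycle) differs from
`n(n+1)·bψ` by a coboundary of the cyclic complex. -/
theorem statement_17 (C : LinCat ℂ) (m : ℕ) (ψ : C.Tup (m + 1) → ℂ)
    (hψ : C.IsCochain ψ)
    (hbψ : ∀ F : C.Tup (m + 2), C.IsCyc F →
      C.lamOp (C.bOp ψ) F = C.bOp ψ F) :
    (C.IsCochain (C.BOp ψ) ∧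
      (∀ F : C.Tup m, C.IsCyc F → C.lamOp (C.BOp ψ) F = C.BOp ψ F) ∧
      (∀ F : C.Tup (m + 1), C.IsCyc F → C.bOp (C.BOp ψ) F = 0)) ∧
    (∀ (Obj' : Type) (S : DGStr ℂ Obj') (Tr : GrTrace S m)
      (ρ : SemiFun0 C.toSemiCat S),
      IsCharOf C S Tr ρ (C.BOp ψ) →
      ∃ χ : C.Tup (m + 1) → ℂ, C.IsCochain χ ∧
        (∀ F : C.Tup (m + 1), C.IsCyc F → C.lamOp χ F = χ F) ∧
        (∀ F : C.Tup (m + 2), C.IsCyc F →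
          C.bOp χ F = sCharOp C Tr ρ F -
            (((m : ℂ) + 1) * ((m : ℂ) + 2)) * C.bOp ψ F)) := by
  have hlam : C.lamEnd (m + 2) (C.hochschild (m + 1) ψ) = C.hochschild (m + 1) ψ :=
    LinCat.IsCochain.ext C hψ.hochschild.lamEnd hψ.hochschild fun F hF => by
      rw [C.lamEnd_apply, C.hochschild_apply]
      exact hbψ F hF
  have hB : C.BOp ψ = C.normEnd m (C.B0Op ψ) := (C.normEnd_apply _).symm
  have hb := hψ.hochschild_BOp hlam
  refine ⟨⟨?_, fun F _ => ?_, fun F _ => ?_⟩, fun Obj' S Tr ρ hρ => ?_⟩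
  · rw [hB]
    exact hψ.B0Op.normEnd
  · rw [← C.lamEnd_apply, hB, C.lamEnd_normEnd]
  · rw [← C.hochschild_apply, hb, Pi.zero_apply]
  · obtain ⟨χ, hχ, hχlam, hχb⟩ := hψ.exists_cyclic_weightedCoface_sub hlam
    refine ⟨χ, hχ, fun F _ => ?_, fun F hF => ?_⟩
    · rw [← C.lamEnd_apply, hχlam]
    · rw [← C.hochschild_apply, hχb, C.sCharOp_eq ρ Tr hρ hF, ← C.hochschild_weightedCoface hb,
        ← C.hochschild_apply]
      rfl
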